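/- arXiv:2302.05537 — 6 statements merged into one kernel-verified Lean document; each statement's English description precedes it below -/
import Mathlib

section
/- There is an absolute constant C ≥ 1 such that the following holds. Let F be a finite field with q elements, n ≥ 1, and suppose A ⊆ 𝔽_q^n has |A| ≥ 2^{−d}·q^n for some real d ≥ 1. Let k ≥ 1 be an integer and ε ∈ (0, 1], and suppose there exist nonempty sets B, C′ ⊆ 𝔽_q^n with |B| ≥ 2^{−k}·q^n and |C′| ≥ 2^{−k}·q^n such that ⟨B * C′, A⟩ ≥ 1 + ε, where A, B, C′ also denote the density functions of these sets. Then there is an affine subspace V of 𝔽_q^n with codimension at most C·(d·k⁷/ε⁶ + d·k³·(log(2/ε))⁴/ε⁶) such that E_{v∈V} A(v) ≥ 1 + ε/8, i.e., |A ∩ V| · q^n ≥ (1 + ε/8) · |A| · |V|. -/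
open scoped Classical

/-- The density function of a set `A ⊆ G`: `(|G|/|A|)·1_A`. -/
noncomputable def dens {G : Type*} [Fintype G] (A : Finset G) : G → ℝ :=
  fun x => if x ∈ A then (Fintype.card G : ℝ) / (A.card : ℝ) else 0

/-- Convolution: `(f * g)(x) = E_{y∈G} f(y)·g(x − y)`. -/
noncomputable def convC {G : Type*} [AddCommGroup G] [Fintype G] (f g : G → ℝ) : G → ℝ :=
  fun x => (∑ y, f y * g (x - y)) / (Fintype.card G : ℝ)

/-- Normalized inner product: `⟨f, g⟩ = E_{x∈G} f(x)·g(x)`. -/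
noncomputable def inn {G : Type*} [Fintype G] (f g : G → ℝ) : ℝ :=
  (∑ x, f x * g x) / (Fintype.card G : ℝ)

/-- Hoeffding's lemma for a finite uniform average. -/
theorem sum_exp_le_of_sum_eq_zero {ι : Type*} (s : Finset ι) (h : ι → ℝ)
    (hb : ∀ i ∈ s, |h i| ≤ 1) (h0 : ∑ i ∈ s, h i = 0) (l : ℝ) :
    ∑ i ∈ s, Real.exp (l * h i) ≤ s.card * Real.exp (l ^ 2 / 2) := by
  have key : ∀ i ∈ s, Real.exp (l * h i) ≤ Real.cosh l + h i * Real.sinh l := by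
    intro i hi
    obtain ⟨h1, h2⟩ := abs_le.1 (hb i hi)
    have hc := convexOn_exp.2 (Set.mem_univ l) (Set.mem_univ (-l))
      (show 0 ≤ (1 + h i) / 2 by linarith) (show 0 ≤ (1 - h i) / 2 by linarith) (by ring)
    simp only [smul_eq_mul] at hc
    rw [Real.cosh_eq, Real.sinh_eq]
    calc Real.exp (l * h i) = Real.exp ((1 + h i) / 2 * l + (1 - h i) / 2 * -l) := by ring_nf
      _ ≤ _ := hc
      _ = _ := by ring
  calc _ ≤ ∑ i ∈ s, (Real.cosh l + h i * Real.sinh l) := Finset.sum_le_sum key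
    _ = s.card * Real.cosh l := by
      rw [Finset.sum_add_distrib, ← Finset.sum_mul, h0]; simp
    _ ≤ _ := by gcongr; exact Real.cosh_le_exp_half_sq l

/-- One-sided Hoeffding inequality for independent uniform samples. -/
theorem card_filter_lt_sum_le {ι : Type*} (s : Finset ι) (h : ι → ℝ)
    (hb : ∀ i ∈ s, |h i| ≤ 1) (h0 : ∑ i ∈ s, h i = 0) (M : ℕ) (δ : ℝ) (hδ : 0 ≤ δ) :
    (((Fintype.piFinset fun _ : Fin M => s).filter fun a => δ * M < ∑ j, h (a j)).card : ℝ) ≤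
      Real.exp (-(δ ^ 2 * M / 2)) * (s.card : ℝ) ^ M := by
  have h1 : ∑ a ∈ Fintype.piFinset fun _ : Fin M => s, Real.exp (δ * ∑ j, h (a j)) ≤
      (s.card * Real.exp (δ ^ 2 / 2)) ^ M := by
    have : ∑ a ∈ Fintype.piFinset fun _ : Fin M => s, Real.exp (δ * ∑ j, h (a j)) =
        (∑ i ∈ s, Real.exp (δ * h i)) ^ M := by
      rw [Finset.sum_pow']
      refine Finset.sum_congr rfl fun a _ => ?_
      rw [Finset.mul_sum, Real.exp_sum]
    rw [this]
    exact pow_le_pow_left₀ (Finset.sum_nonneg fun _ _ => (Real.exp_pos _).le)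
      (sum_exp_le_of_sum_eq_zero s h hb h0 δ) M
  have h2 : (((Fintype.piFinset fun _ : Fin M => s).filter
      fun a => δ * M < ∑ j, h (a j)).card : ℝ) * Real.exp (δ ^ 2 * M) ≤
      ∑ a ∈ Fintype.piFinset fun _ : Fin M => s, Real.exp (δ * ∑ j, h (a j)) := by
    rw [← nsmul_eq_mul]
    refine (Finset.card_nsmul_le_sum _ (fun a => Real.exp (δ * ∑ j, h (a j))) _ ?_).trans
      (Finset.sum_le_sum_of_subset_of_nonneg (Finset.filter_subset _ _)
        fun _ _ _ => (Real.exp_pos _).le)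
    intro a ha
    have := (Finset.mem_filter.1 ha).2
    apply Real.exp_le_exp.2
    nlinarith
  have h3 : (s.card * Real.exp (δ ^ 2 / 2)) ^ M =
      Real.exp (-(δ ^ 2 * M / 2)) * (s.card : ℝ) ^ M * Real.exp (δ ^ 2 * M) := by
    rw [mul_pow, ← Real.exp_nat_mul, mul_right_comm, ← Real.exp_add, mul_comm]
    ring_nf
  exact le_of_mul_le_mul_right (h2.trans (h1.trans_eq h3)) (Real.exp_pos _)

theorem card_filter_lt_abs_sum_le {ι : Type*} (s : Finset ι) (h : ι → ℝ)
    (hb : ∀ i ∈ s, |h i| ≤ 1) (h0 : ∑ i ∈ s, h i = 0) (M : ℕ) (δ : ℝ) (hδ : 0 ≤ δ) :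
    (((Fintype.piFinset fun _ : Fin M => s).filter fun a => δ * M < |∑ j, h (a j)|).card : ℝ) ≤
      2 * Real.exp (-(δ ^ 2 * M / 2)) * (s.card : ℝ) ^ M := by
  have h1 := card_filter_lt_sum_le s h hb h0 M δ hδ
  have h2 := card_filter_lt_sum_le s (fun i => -h i) (by simpa using hb) (by simpa using h0) M δ hδ
  have h3 : ((Fintype.piFinset fun _ : Fin M => s).filter fun a => δ * M < |∑ j, h (a j)|) ⊆
      ((Fintype.piFinset fun _ : Fin M => s).filter fun a => δ * M < ∑ j, h (a j)) ∪
      ((Fintype.piFinset fun _ : Fin M => s).filter fun a => δ * M < ∑ j, -h (a j)) := by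
    intro a
    simp only [Finset.mem_filter, Finset.mem_union, lt_abs, Finset.sum_neg_distrib]
    tauto
  have h4 := (Finset.card_le_card h3).trans (Finset.card_union_le _ _)
  have h5 := (Nat.cast_le (α := ℝ)).2 h4
  push_cast at h5
  linarith

/-- Croot–Sisask: a set `T` of translations along which the average of `f` over `A` is
simultaneously approximated by translates of one function `g`, outside small sets. -/
theorem exists_croot_sisask {G : Type*} [AddCommGroup G] [Fintype G] (A : Finset G)
    (hA : A.Nonempty) (f : G → ℝ) (hf0 : ∀ x, 0 ≤ f x) (hf1 : ∀ x, f x ≤ 1) (M : ℕ) (hM : 1 ≤ M)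
    (δ : ℝ) (hδ : 0 ≤ δ) :
    ∃ (T : Finset G) (g : G → ℝ),
      (A.card : ℝ) ^ M * Fintype.card G ≤ 2 * T.card * (Fintype.card G : ℝ) ^ M ∧
      ∀ t ∈ T, ((Finset.univ.filter fun y =>
        δ < |g (y - t) - (∑ a ∈ A, f (a - y)) / A.card|).card : ℝ) ≤
          4 * Real.exp (-(δ ^ 2 * M / 2)) * Fintype.card G := by
  set Fa : G → ℝ := fun y => (∑ a ∈ A, f (a - y)) / A.card with hFa
  set κ : ℝ := Real.exp (-(δ ^ 2 * M / 2)) with hκ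
  have hκ0 : 0 < κ := Real.exp_pos _
  set P := Fintype.piFinset fun _ : Fin M => A with hP
  have hPc : (P.card : ℝ) = (A.card : ℝ) ^ M := by simp [hP]
  have hA0 : (0:ℝ) < A.card := by exact_mod_cast hA.card_pos
  have hM0 : (0:ℝ) < M := by exact_mod_cast hM
  have hN0 : (0:ℝ) < Fintype.card G := by exact_mod_cast Fintype.card_pos
  set gg : (Fin M → G) → G → ℝ := fun a y => (∑ j, f (a j - y)) / M with hgg
  set E : (Fin M → G) → Finset G := fun a => Finset.univ.filter fun y => δ < |gg a y - Fa y|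
    with hE
  have hF01 : ∀ y, 0 ≤ Fa y ∧ Fa y ≤ 1 := by
    intro y
    refine ⟨div_nonneg (Finset.sum_nonneg fun _ _ => hf0 _) hA0.le, ?_⟩
    rw [hFa, div_le_one hA0]
    calc ∑ a ∈ A, f (a - y) ≤ ∑ a ∈ A, 1 := Finset.sum_le_sum fun _ _ => hf1 _
      _ = _ := by simp
  have hpt : ∀ y, ((P.filter fun a => y ∈ E a).card : ℝ) ≤ 2 * κ * (A.card : ℝ) ^ M := by
    intro y
    have := card_filter_lt_abs_sum_le A (fun a => f (a - y) - Fa y)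
      (fun a _ => by
        rw [abs_le]; constructor <;> linarith [hf0 (a - y), hf1 (a - y), (hF01 y).1, (hF01 y).2])
      (by
        rw [Finset.sum_sub_distrib]
        simp only [Finset.sum_const, nsmul_eq_mul, hFa]
        field_simp
        ring) M δ hδ
    refine le_trans (le_of_eq ?_) this
    congr 2
    refine Finset.filter_congr fun a _ => ?_
    simp only [hE, Finset.mem_filter, Finset.mem_univ, true_and, hgg]
    rw [Finset.sum_sub_distrib]
    simp only [Finset.sum_const, nsmul_eq_mul, Finset.card_univ, Fintype.card_fin]
    rw [show (∑ j, f (a j - y)) / M - Fa y = (∑ j, f (a j - y) - M * Fa y) / M by field_simp,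
      abs_div, abs_of_pos hM0, lt_div_iff₀ hM0]
  have hsum : ∑ a ∈ P, ((E a).card : ℝ) ≤ 2 * κ * (A.card : ℝ) ^ M * Fintype.card G := by
    have h1 : ∑ a ∈ P, ((E a).card : ℝ) = ∑ y : G, ((P.filter fun a => y ∈ E a).card : ℝ) := by
      simp only [Finset.card_eq_sum_ones, Nat.cast_sum, Finset.sum_filter, hE, Nat.cast_ite]
      rw [Finset.sum_comm]
      simp
    rw [h1]
    calc _ ≤ ∑ y : G, 2 * κ * (A.card : ℝ) ^ M := Finset.sum_le_sum fun y _ => hpt y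
      _ = _ := by simp; ring
  set Lg := P.filter fun a => ((E a).card : ℝ) ≤ 4 * κ * Fintype.card G with hLg
  have hL : (A.card : ℝ) ^ M ≤ 2 * Lg.card := by
    have h1 : ((P.filter fun a => ¬ ((E a).card : ℝ) ≤ 4 * κ * Fintype.card G).card : ℝ) *
        (4 * κ * Fintype.card G) ≤ ∑ a ∈ P, ((E a).card : ℝ) := by
      rw [← nsmul_eq_mul]
      refine (Finset.card_nsmul_le_sum _ (fun a => ((E a).card : ℝ)) _ ?_).trans
        (Finset.sum_le_sum_of_subset_of_nonneg (Finset.filter_subset _ _)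
          fun _ _ _ => Nat.cast_nonneg _)
      intro a ha
      exact (not_le.1 (Finset.mem_filter.1 ha).2).le
    have h2 : (Lg.card : ℝ) +
        (P.filter fun a => ¬ ((E a).card : ℝ) ≤ 4 * κ * Fintype.card G).card = P.card := by
      exact_mod_cast Finset.card_filter_add_card_filter_not _
    have h3 := h1.trans hsum
    have h4 : ((P.filter fun a => ¬ ((E a).card : ℝ) ≤ 4 * κ * Fintype.card G).card : ℝ) * 2 ≤
        (A.card : ℝ) ^ M := by
      refine le_of_mul_le_mul_right (a := 2 * κ * Fintype.card G) ?_ (by positivity)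
      linarith
    rw [hPc] at h2
    linarith
  have hpig : ∃ x : Fin M → G, (Lg.card : ℝ) * Fintype.card G ≤
      ((Finset.univ.filter fun t : G => (fun j => x j + t) ∈ Lg).card : ℝ) *
        (Fintype.card G : ℝ) ^ M := by
    by_contra! hcon
    have h1 : ∑ x : Fin M → G, ((Finset.univ.filter fun t : G => (fun j => x j + t) ∈ Lg).card : ℝ)
        = Lg.card * Fintype.card G := by
      simp only [Finset.card_eq_sum_ones, Nat.cast_sum, Finset.sum_filter, Nat.cast_ite]
      rw [Finset.sum_comm]
      have : ∀ t : G, ∑ x : Fin M → G, (if (fun j => x j + t) ∈ Lg then ((1:ℕ):ℝ) else ((0:ℕ):ℝ))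
          = Lg.card := by
        intro t
        refine (Equiv.sum_comp (Equiv.addRight (fun _ : Fin M => t))
          (fun x : Fin M → G => if x ∈ Lg then ((1:ℕ):ℝ) else ((0:ℕ):ℝ))).trans ?_
        simp
      rw [Finset.sum_congr rfl fun t _ => this t]
      simp; ring
    have h2 := Finset.sum_lt_sum_of_nonempty (Finset.univ_nonempty (α := Fin M → G))
      fun x _ => hcon x
    rw [← Finset.sum_mul, h1] at h2
    simp at h2
    exact h2.ne (by ring)
  obtain ⟨x, hx⟩ := hpig
  refine ⟨Finset.univ.filter fun t : G => (fun j => x j + t) ∈ Lg, gg x, ?_, ?_⟩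
  · calc (A.card : ℝ) ^ M * Fintype.card G ≤ 2 * Lg.card * Fintype.card G := by gcongr
      _ = 2 * (Lg.card * Fintype.card G) := by ring
      _ ≤ _ := by rw [mul_assoc]; gcongr
  · intro t ht
    have h1 := (Finset.mem_filter.1 (Finset.mem_filter.1 ht).2).2
    refine le_trans (le_of_eq ?_) h1
    congr 2
    ext y
    simp only [hE, hgg, hFa, Finset.mem_filter, Finset.mem_univ, true_and, sub_sub_eq_add_sub]

/-- The average of `Φ (z + t - s)` over `t, s ∈ T`. -/
noncomputable def avgDiff {G : Type*} [AddCommGroup G] (T : Finset G) (Φ : G → ℝ) : G → ℝ :=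
  fun z => (∑ t ∈ T, ∑ t' ∈ T, Φ (z + t - t')) / (T.card : ℝ) ^ 2

theorem abs_avg_translate_sub_le {G : Type*} [AddCommGroup G] [Fintype G] (C T : Finset G)
    (hC : C.Nonempty) (F g : G → ℝ) (hF0 : ∀ x, 0 ≤ F x) (hF1 : ∀ x, F x ≤ 1) (δ K : ℝ)
    (hδ : 0 ≤ δ)
    (hg : ∀ t ∈ T, ((Finset.univ.filter fun y => δ < |g (y - t) - F y|).card : ℝ) ≤ K)
    (t : G) (ht : t ∈ T) (t' : G) (ht' : t' ∈ T) (z : G) :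
    |(∑ c ∈ C, F (c + (z + t - t'))) / C.card - (∑ c ∈ C, F (c + z)) / C.card| ≤
      2 * δ + 2 * K / C.card := by
  have hC0 : (0:ℝ) < C.card := by exact_mod_cast hC.card_pos
  set E : G → Finset G := fun t => Finset.univ.filter fun y => δ < |g (y - t) - F y| with hE
  have hmem : ∀ s y, y ∉ E s → |g (y - s) - F y| ≤ δ := by
    intro s y hy
    simpa [hE] using hy
  have hone : ∀ y y', |F y - F y'| ≤ 1 := by
    intro y y'
    rw [abs_le]
    constructor <;> linarith [hF0 y, hF0 y', hF1 y, hF1 y']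
  have hpt : ∀ c ∈ C, |F (c + (z + t - t')) - F (c + z)| ≤
      2 * δ + ((if c + z ∈ E t' then 1 else 0) + (if c + (z + t - t') ∈ E t then 1 else 0)) := by
    intro c _
    have h1 := hone (c + (z + t - t')) (c + z)
    split_ifs with h2 h3 h3
    · linarith
    · linarith
    · linarith
    · have h4 := abs_le.1 (hmem _ _ h2)
      have h5 := abs_le.1 (hmem _ _ h3)
      rw [show c + (z + t - t') - t = c + z - t' by abel] at h5
      rw [abs_le]
      constructor <;> linarith [h4.1, h4.2, h5.1, h5.2]
  have hind : ∀ s ∈ T, ∀ u : G, ∑ c ∈ C, (if c + u ∈ E s then (1:ℝ) else 0) ≤ K := by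
    intro s hs u
    refine le_trans ?_ (hg s hs)
    rw [← Finset.sum_filter, Finset.sum_const, nsmul_one]
    norm_cast
    refine Finset.card_le_card_of_injOn (fun c => c + u) ?_ (fun a _ b _ h => by simpa using h)
    intro c hc
    exact (Finset.mem_filter.1 hc).2
  rw [← sub_div, ← Finset.sum_sub_distrib, abs_div, abs_of_pos hC0, div_le_iff₀ hC0]
  calc |∑ c ∈ C, (F (c + (z + t - t')) - F (c + z))|
      ≤ ∑ c ∈ C, |F (c + (z + t - t')) - F (c + z)| := Finset.abs_sum_le_sum_abs _ _
    _ ≤ _ := Finset.sum_le_sum hpt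
    _ ≤ C.card * (2 * δ) + (K + K) := by
      rw [Finset.sum_add_distrib, Finset.sum_add_distrib]
      gcongr
      · simp
      · exact hind t' ht' z
      · exact hind t ht _
    _ = _ := by field_simp; ring

theorem abs_iterate_avgDiff_sub_le {G : Type*} [AddCommGroup G] (T : Finset G)
    (hT : T.Nonempty) (Φ : G → ℝ) (D : ℝ)
    (h : ∀ t ∈ T, ∀ t' ∈ T, ∀ z, |Φ (z + t - t') - Φ z| ≤ D) (l : ℕ) :
    ∀ z, |(avgDiff T)^[l] Φ z - Φ z| ≤ l * D := by
  have hT0 : (0:ℝ) < T.card := by exact_mod_cast hT.card_pos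
  induction l with
  | zero => simp
  | succ l ih =>
    intro z
    rw [Function.iterate_succ_apply']
    set Ψ := (avgDiff T)^[l] Φ
    have h1 : avgDiff T Ψ z - Φ z =
        (∑ t ∈ T, ∑ t' ∈ T, (Ψ (z + t - t') - Φ z)) / (T.card : ℝ) ^ 2 := by
      simp only [avgDiff, Finset.sum_sub_distrib, Finset.sum_const, nsmul_eq_mul]
      field_simp
    rw [h1, abs_div, abs_of_pos (by positivity : (0:ℝ) < (T.card : ℝ) ^ 2),
      div_le_iff₀ (by positivity)]
    calc _ ≤ ∑ t ∈ T, ∑ t' ∈ T, |Ψ (z + t - t') - Φ z| :=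
          (Finset.abs_sum_le_sum_abs _ _).trans
            (Finset.sum_le_sum fun _ _ => Finset.abs_sum_le_sum_abs _ _)
      _ ≤ ∑ t ∈ T, ∑ t' ∈ T, ((l + 1 : ℕ) * D) := by
        refine Finset.sum_le_sum fun t ht => Finset.sum_le_sum fun t' ht' => ?_
        have h2 := ih (z + t - t')
        have h3 := h t ht t' ht' z
        have h4 := abs_sub_le (Ψ (z + t - t')) (Φ (z + t - t')) (Φ z)
        push_cast
        linarith
      _ = _ := by simp; ring

section Fourier

variable {F : Type*} [Field F] [Fintype F] {n : ℕ}

theorem sum_addChar_dotProduct (ψ : AddChar F ℂ) (hψ : ψ ≠ 1) (x : Fin n → F) :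
    ∑ v : Fin n → F, ψ (v ⬝ᵥ x) = if x = 0 then (Fintype.card (Fin n → F) : ℂ) else 0 := by
  split_ifs with hx
  · simp [hx]
  · obtain ⟨j, hj⟩ := Function.ne_iff.1 hx
    obtain ⟨u, hu⟩ := AddChar.ne_one_iff.1 hψ
    have h1 : ∑ v : Fin n → F, ψ (v ⬝ᵥ x) = ψ u * ∑ v : Fin n → F, ψ (v ⬝ᵥ x) := by
      rw [Finset.mul_sum, ← Equiv.sum_comp (Equiv.addLeft (Pi.single j (u / x j)))]
      refine Finset.sum_congr rfl fun v _ => ?_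
      have : x j ≠ 0 := hj
      simp [add_dotProduct, AddChar.map_add_eq_mul, this]
    by_contra h
    exact hu (mul_right_cancel₀ h (by rw [one_mul]; exact h1.symm))

theorem sum_norm_sq_fourier (ψ : AddChar F ℂ) (hψ : ψ ≠ 1) (u : (Fin n → F) → ℝ) :
    ∑ v : Fin n → F, ‖∑ y, (u y : ℂ) * ψ (v ⬝ᵥ y)‖ ^ 2 =
      Fintype.card (Fin n → F) * ∑ y, u y ^ 2 := by
  have key : (∑ v : Fin n → F, (∑ y, (u y : ℂ) * ψ (v ⬝ᵥ y)) *
      (starRingEnd ℂ) (∑ y, (u y : ℂ) * ψ (v ⬝ᵥ y))) =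
      Fintype.card (Fin n → F) * ∑ y, (u y : ℂ) ^ 2 := by
    have h1 : ∀ v : Fin n → F, (∑ y, (u y : ℂ) * ψ (v ⬝ᵥ y)) *
      (starRingEnd ℂ) (∑ y, (u y : ℂ) * ψ (v ⬝ᵥ y)) =
        ∑ y, ∑ y', (u y : ℂ) * u y' * ψ (v ⬝ᵥ (y - y')) := by
      intro v
      rw [map_sum, Finset.sum_mul_sum]
      refine Finset.sum_congr rfl fun y _ => Finset.sum_congr rfl fun y' _ => ?_
      rw [map_mul, ← AddChar.map_neg_eq_conj, dotProduct_sub, sub_eq_add_neg,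
        AddChar.map_add_eq_mul, Complex.conj_ofReal]
      ring
    rw [Finset.sum_congr rfl fun v _ => h1 v, Finset.sum_comm, Finset.mul_sum]
    refine Finset.sum_congr rfl fun y _ => ?_
    rw [Finset.sum_comm]
    simp_rw [← Finset.mul_sum, sum_addChar_dotProduct ψ hψ, sub_eq_zero]
    simp
    ring
  have h2 : ∀ z : ℂ, z * (starRingEnd ℂ) z = ((‖z‖ ^ 2 : ℝ) : ℂ) := by
    intro z
    rw [Complex.mul_conj, Complex.normSq_eq_norm_sq]
  simp_rw [h2] at key
  exact_mod_cast key

theorem fourier_inversion (ψ : AddChar F ℂ) (hψ : ψ ≠ 1) (u : (Fin n → F) → ℝ) (y : Fin n → F) :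
    ∑ v : Fin n → F, (∑ x, (u x : ℂ) * ψ⁻¹ (v ⬝ᵥ x)) * ψ (v ⬝ᵥ y) =
      Fintype.card (Fin n → F) * u y := by
  simp_rw [Finset.sum_mul]
  rw [Finset.sum_comm]
  have h1 : ∀ x v : Fin n → F, (u x : ℂ) * ψ⁻¹ (v ⬝ᵥ x) * ψ (v ⬝ᵥ y) =
      u x * ψ (v ⬝ᵥ (y - x)) := by
    intro x v
    rw [AddChar.inv_apply, mul_assoc, ← AddChar.map_add_eq_mul, dotProduct_sub]
    congr 2
    ring
  simp_rw [h1, ← Finset.mul_sum, sum_addChar_dotProduct ψ hψ, sub_eq_zero]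
  simp
  ring

/-- Translates `z ↦ E_{c ∈ C} f (c + z)` of a bounded function have small Wiener norm. -/
theorem exists_fourier_expansion (ψ : AddChar F ℂ) (hψ : ψ ≠ 1) (C : Finset (Fin n → F))
    (hC : C.Nonempty) (f : (Fin n → F) → ℝ) (hf0 : ∀ x, 0 ≤ f x) (hf1 : ∀ x, f x ≤ 1) :
    ∃ a : (Fin n → F) → ℂ,
      (∀ z, (((∑ c ∈ C, f (c + z)) / C.card : ℝ) : ℂ) = ∑ v, a v * ψ (v ⬝ᵥ z)) ∧
      (∑ v, ‖a v‖) ^ 2 ≤ Fintype.card (Fin n → F) / C.card := by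
  have hC0 : (0:ℝ) < C.card := by exact_mod_cast hC.card_pos
  have hN0 : (0:ℝ) < Fintype.card (Fin n → F) := by exact_mod_cast Fintype.card_pos
  have hC0' : (C.card : ℂ) ≠ 0 := by exact_mod_cast hC0.ne'
  have hN0' : (Fintype.card (Fin n → F) : ℂ) ≠ 0 := by exact_mod_cast hN0.ne'
  set fh : (Fin n → F) → ℂ := fun v => ∑ x, (f x : ℂ) * ψ⁻¹ (v ⬝ᵥ x) with hfh
  set ch : (Fin n → F) → ℂ := fun v => ∑ c ∈ C, ψ (v ⬝ᵥ c) with hch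
  have hψ' : ψ⁻¹ ≠ 1 := by simpa using hψ
  refine ⟨fun v => fh v * ch v / (Fintype.card (Fin n → F) * C.card), ?_, ?_⟩
  · intro z
    push_cast
    have h1 : ∀ c, (f (c + z) : ℂ) =
        (∑ v, fh v * (ψ (v ⬝ᵥ c) * ψ (v ⬝ᵥ z))) / Fintype.card (Fin n → F) := by
      intro c
      rw [eq_div_iff hN0', mul_comm, ← fourier_inversion ψ hψ f]
      refine Finset.sum_congr rfl fun v _ => ?_
      rw [dotProduct_add, AddChar.map_add_eq_mul]
    simp_rw [h1]
    rw [← Finset.sum_div, Finset.sum_comm, div_div, Finset.sum_div]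
    refine Finset.sum_congr rfl fun v _ => ?_
    rw [hch]
    simp only
    rw [← Finset.mul_sum, ← Finset.sum_mul]
    ring
  · have h1 : ∑ v, ‖fh v‖ ^ 2 ≤ (Fintype.card (Fin n → F) : ℝ) ^ 2 := by
      rw [hfh, sum_norm_sq_fourier ψ⁻¹ hψ' f, sq]
      gcongr
      calc ∑ y, f y ^ 2 ≤ ∑ y : Fin n → F, 1 :=
            Finset.sum_le_sum fun y _ => pow_le_one₀ (hf0 y) (hf1 y)
        _ = _ := by simp
    have h2 : ∑ v, ‖ch v‖ ^ 2 = Fintype.card (Fin n → F) * C.card := by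
      have := sum_norm_sq_fourier ψ hψ (fun y => if y ∈ C then 1 else 0)
      simpa [hch, apply_ite, ite_mul, Finset.sum_ite_mem] using this
    have h3 : ∑ v, ‖fh v * ch v / (Fintype.card (Fin n → F) * C.card)‖ =
        (∑ v, ‖fh v‖ * ‖ch v‖) / (Fintype.card (Fin n → F) * C.card) := by
      rw [Finset.sum_div]
      refine Finset.sum_congr rfl fun v _ => ?_
      rw [norm_div, norm_mul, norm_mul, Complex.norm_natCast, Complex.norm_natCast]
    rw [h3, div_pow, div_le_div_iff₀ (by positivity) hC0]
    calc _ ≤ ((∑ v, ‖fh v‖ ^ 2) * ∑ v, ‖ch v‖ ^ 2) * C.card := by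
          gcongr; exact Finset.sum_mul_sq_le_sq_mul_sq _ _ _
      _ ≤ ((Fintype.card (Fin n → F) : ℝ) ^ 2 * (Fintype.card (Fin n → F) * C.card)) * C.card := by
          rw [h2]; gcongr
      _ = _ := by ring

theorem iterate_avgDiff_expansion (ψ : AddChar F ℂ) (T : Finset (Fin n → F))
    (Φ : (Fin n → F) → ℝ) (a : (Fin n → F) → ℂ) (h : ∀ z, (Φ z : ℂ) = ∑ v, a v * ψ (v ⬝ᵥ z))
    (l : ℕ) (z : Fin n → F) :
    (((avgDiff T)^[l] Φ z : ℝ) : ℂ) =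
      ∑ v, a v * ((‖∑ t ∈ T, ψ (v ⬝ᵥ t)‖ / T.card : ℝ) : ℂ) ^ (2 * l) * ψ (v ⬝ᵥ z) := by
  induction l generalizing z with
  | zero => simp [h]
  | succ l ih =>
    rw [Function.iterate_succ_apply']
    set Ψ := (avgDiff T)^[l] Φ
    simp only [avgDiff]
    push_cast
    simp_rw [ih]
    have h1 : ∀ v, ∑ t ∈ T, ∑ t' ∈ T, ψ (v ⬝ᵥ (z + t - t')) =
        ψ (v ⬝ᵥ z) * (‖∑ t ∈ T, ψ (v ⬝ᵥ t)‖ : ℂ) ^ 2 := by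
      intro v
      rw [← Complex.ofReal_pow, ← Complex.normSq_eq_norm_sq, ← Complex.mul_conj, map_sum,
        Finset.sum_mul_sum, Finset.mul_sum]
      refine Finset.sum_congr rfl fun t _ => ?_
      rw [Finset.mul_sum]
      refine Finset.sum_congr rfl fun t' _ => ?_
      rw [← AddChar.map_neg_eq_conj, ← AddChar.map_add_eq_mul, ← AddChar.map_add_eq_mul,
        dotProduct_sub, dotProduct_add]
      congr 1
      ring
    have h2 : ∀ b : (Fin n → F) → ℂ, ∑ t ∈ T, ∑ t' ∈ T, ∑ v, b v * ψ (v ⬝ᵥ (z + t - t')) =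
        ∑ v, b v * (ψ (v ⬝ᵥ z) * (‖∑ t ∈ T, ψ (v ⬝ᵥ t)‖ : ℂ) ^ 2) := by
      intro b
      simp_rw [← h1, Finset.mul_sum]
      symm
      rw [Finset.sum_comm]
      refine Finset.sum_congr rfl fun t _ => ?_
      rw [Finset.sum_comm]
    rw [h2, Finset.sum_div]
    refine Finset.sum_congr rfl fun v _ => ?_
    push_cast
    rw [mul_add, pow_add, div_pow _ _ (2 * 1)]
    ring

/-- Iterated averaging over a difference set makes a function with small Wiener norm nearly
invariant under the annihilator of the large spectrum. -/
theorem abs_iterate_avgDiff_translate_le (ψ : AddChar F ℂ) (T : Finset (Fin n → F))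
    (Φ : (Fin n → F) → ℝ) (a : (Fin n → F) → ℂ) (h : ∀ z, (Φ z : ℂ) = ∑ v, a v * ψ (v ⬝ᵥ z))
    (l : ℕ) (w : Fin n → F)
    (hw : ∀ v : Fin n → F, 1 / 2 ≤ ‖∑ t ∈ T, ψ (v ⬝ᵥ t)‖ / T.card → v ⬝ᵥ w = 0) :
    |(avgDiff T)^[l] Φ w - (avgDiff T)^[l] Φ 0| ≤ 2 * (1 / 2) ^ (2 * l) * ∑ v, ‖a v‖ := by
  rw [← Real.norm_eq_abs, ← Complex.norm_real]
  push_cast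
  rw [iterate_avgDiff_expansion ψ T Φ a h, iterate_avgDiff_expansion ψ T Φ a h,
    ← Finset.sum_sub_distrib, Finset.mul_sum]
  refine (norm_sum_le _ _).trans (Finset.sum_le_sum fun v _ => ?_)
  rw [← mul_sub, dotProduct_zero, AddChar.map_zero_eq_one, norm_mul, norm_mul, norm_pow,
    Complex.norm_real, Real.norm_of_nonneg (by positivity)]
  by_cases hv : 1 / 2 ≤ ‖∑ t ∈ T, ψ (v ⬝ᵥ t)‖ / T.card
  · rw [hw v hv, AddChar.map_zero_eq_one]
    simp
  · have h1 : ‖ψ (v ⬝ᵥ w) - 1‖ ≤ 2 := by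
      refine (norm_sub_le _ _).trans ?_
      rw [AddChar.norm_apply, norm_one]; norm_num
    have h2 : (‖∑ t ∈ T, ψ (v ⬝ᵥ t)‖ / T.card) ^ (2 * l) ≤ (1 / 2) ^ (2 * l) :=
      pow_le_pow_left₀ (by positivity) (not_le.1 hv).le _
    calc _ ≤ ‖a v‖ * (1 / 2) ^ (2 * l) * 2 := by gcongr
      _ = _ := by ring

theorem card_mul_sum_comp_of_surjective {G H : Type*} [AddCommGroup G] [AddCommGroup H]
    [Fintype G] [Fintype H] (L : G →+ H) (hL : Function.Surjective L) (f : H → ℝ) :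
    Fintype.card H * ∑ x, f (L x) = Fintype.card G * ∑ u, f u := by
  have h1 : ∀ u : H, ∑ x, f (L x + u) = ∑ x, f (L x) := by
    intro u
    obtain ⟨v, rfl⟩ := hL u
    rw [← Equiv.sum_comp (Equiv.addRight v) fun x => f (L x)]
    simp
  have h2 : ∀ x : G, ∑ u, f (L x + u) = ∑ u, f u := fun x =>
    Equiv.sum_comp (Equiv.addLeft (L x)) f
  calc (Fintype.card H : ℝ) * ∑ x, f (L x) = ∑ u : H, ∑ x, f (L x + u) := by
        rw [Finset.sum_congr rfl fun u _ => h1 u]; simp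
    _ = _ := by rw [Finset.sum_comm, Finset.sum_congr rfl fun x _ => h2 x]; simp

/-- Chang's theorem for linearly independent frequencies. -/
theorem chang {ι : Type*} [Fintype ι] (ψ : AddChar F ℂ) (hψ : ψ ≠ 1)
    (T : Finset (Fin n → F)) (hT : T.Nonempty) (v : ι → Fin n → F) (hv : LinearIndependent F v)
    (h : ∀ i, 1 / 2 ≤ ‖∑ t ∈ T, ψ (v i ⬝ᵥ t)‖ / T.card) :
    (Fintype.card ι : ℝ) ≤ 8 * Real.log (Fintype.card (Fin n → F) / T.card) := by
  have hT0 : (0:ℝ) < T.card := by exact_mod_cast hT.card_pos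
  have hN0 : (0:ℝ) < Fintype.card (Fin n → F) := by exact_mod_cast Fintype.card_pos
  set S : ι → ℂ := fun i => ∑ t ∈ T, ψ (v i ⬝ᵥ t) with hS
  have hS1 : ∀ i, T.card / 2 ≤ ‖S i‖ := fun i => by
    have := h i
    rw [le_div_iff₀ hT0] at this
    linarith
  have hS0 : ∀ i, ‖S i‖ ≠ 0 := fun i => by
    have := hS1 i
    intro h0
    linarith
  set c : ι → ℂ := fun i => (starRingEnd ℂ) (S i) / ‖S i‖ with hc
  have hc1 : ∀ i, ‖c i‖ = 1 := fun i => by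
    simp only [hc, norm_div, RCLike.norm_conj, Complex.norm_real, norm_norm]
    exact div_self (hS0 i)
  have hcS : ∀ i, c i * S i = ‖S i‖ := fun i => by
    have : (‖S i‖ : ℂ) ≠ 0 := by exact_mod_cast hS0 i
    simp only [hc]
    rw [div_mul_eq_mul_div, mul_comm, Complex.mul_conj, Complex.normSq_eq_norm_sq,
      div_eq_iff this]
    push_cast; ring
  set r : ι → F → ℝ := fun i u => (c i * ψ u).re with hr
  have hr1 : ∀ i u, |r i u| ≤ 1 := fun i u => by
    refine (Complex.abs_re_le_norm _).trans ?_
    rw [norm_mul, hc1, AddChar.norm_apply, one_mul]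
  have hr0 : ∀ i, ∑ u, r i u = 0 := fun i => by
    simp only [hr]
    rw [← Complex.re_sum, ← Finset.mul_sum, AddChar.sum_eq_zero_of_ne_one hψ]
    simp
  set Y : (Fin n → F) → ℝ := fun x => ∑ i, r i (v i ⬝ᵥ x) with hY
  have hYT : (Fintype.card ι : ℝ) * (T.card / 2) ≤ ∑ t ∈ T, Y t := by
    simp only [hY]
    rw [Finset.sum_comm, ← nsmul_eq_mul]
    refine Finset.card_nsmul_le_sum _ _ _ fun i _ => ?_
    simp only [hr]
    rw [← Complex.re_sum, ← Finset.mul_sum]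
    change _ ≤ (c i * S i).re
    rw [hcS]
    simpa using hS1 i
  have hlow : (T.card : ℝ) * Real.exp ((Fintype.card ι : ℝ) / 4) ≤
      ∑ x, Real.exp (1 / 2 * Y x) := by
    set b : ℝ := (Fintype.card ι : ℝ) / 4
    calc (T.card : ℝ) * Real.exp b ≤ ∑ t ∈ T, Real.exp b * (1 / 2 * Y t - b + 1) := by
          rw [← Finset.mul_sum, mul_comm]
          gcongr
          rw [Finset.sum_add_distrib, Finset.sum_sub_distrib, ← Finset.mul_sum]
          simp only [Finset.sum_const, nsmul_eq_mul, mul_one]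
          have : (T.card : ℝ) * b = (Fintype.card ι : ℝ) * (T.card / 2) / 2 := by
            simp only [b]; ring
          linarith
      _ ≤ ∑ t ∈ T, Real.exp (1 / 2 * Y t) := by
          refine Finset.sum_le_sum fun t _ => ?_
          calc _ ≤ Real.exp b * Real.exp (1 / 2 * Y t - b) := by
                gcongr; exact Real.add_one_le_exp _
            _ = _ := by rw [← Real.exp_add]; ring_nf
      _ ≤ _ := Finset.sum_le_sum_of_subset_of_nonneg (Finset.subset_univ _)
          fun _ _ _ => (Real.exp_pos _).le
  have hsurj : Function.Surjective (Matrix.mulVecLin (Matrix.of v)) := by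
    rw [← LinearMap.range_eq_top]
    apply Submodule.eq_top_of_finrank_eq
    have := LinearIndependent.rank_matrix (M := Matrix.of v) hv
    rw [Module.finrank_fintype_fun_eq_card]
    exact this
  have hup : ∑ x, Real.exp (1 / 2 * Y x) ≤
      Fintype.card (Fin n → F) * Real.exp ((Fintype.card ι : ℝ) / 8) := by
    have h1 := card_mul_sum_comp_of_surjective
      (Matrix.mulVecLin (Matrix.of v)).toAddMonoidHom hsurj
      (fun u : ι → F => ∏ i, Real.exp (1 / 2 * r i (u i)))
    have h2 : ∑ u : ι → F, ∏ i, Real.exp (1 / 2 * r i (u i)) =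
        ∏ i, ∑ u : F, Real.exp (1 / 2 * r i u) := by
      rw [Finset.prod_univ_sum]
      simp
    have h3 : ∏ i, ∑ u : F, Real.exp (1 / 2 * r i u) ≤
        ∏ _i : ι, (Fintype.card F * Real.exp (1 / 8)) := by
      refine Finset.prod_le_prod (fun i _ => Finset.sum_nonneg fun _ _ => (Real.exp_pos _).le)
        fun i _ => ?_
      have := sum_exp_le_of_sum_eq_zero Finset.univ (r i) (fun u _ => hr1 i u) (hr0 i) (1 / 2)
      norm_num at this ⊢
      exact this
    have h4 : ∀ x, Real.exp (1 / 2 * Y x) = ∏ i, Real.exp (1 / 2 *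
        r i ((Matrix.mulVecLin (Matrix.of v)).toAddMonoidHom x i)) := by
      intro x
      rw [hY, Finset.mul_sum, Real.exp_sum]
      rfl
    rw [h2] at h1
    simp_rw [← h4] at h1
    have hq : (0:ℝ) < Fintype.card (ι → F) := by exact_mod_cast Fintype.card_pos
    refine le_of_mul_le_mul_left (h1.trans_le ?_) hq
    calc _ ≤ (Fintype.card (Fin n → F) : ℝ) * ∏ _i : ι, (Fintype.card F * Real.exp (1 / 8)) := by
          gcongr
      _ = _ := by
        rw [Finset.prod_const, mul_pow, ← Real.exp_nat_mul]
        simp only [Finset.card_univ, Fintype.card_fun]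
        push_cast
        ring_nf
  have h5 := hlow.trans hup
  have h6 : Real.exp ((Fintype.card ι : ℝ) / 8) ≤ Fintype.card (Fin n → F) / T.card := by
    rw [le_div_iff₀ hT0]
    refine le_of_mul_le_mul_right (a := Real.exp ((Fintype.card ι : ℝ) / 8)) ?_ (Real.exp_pos _)
    refine le_trans (le_of_eq ?_) h5
    rw [mul_comm (Real.exp _), mul_assoc, ← Real.exp_add]
    ring_nf
  have h7 := Real.log_le_log (Real.exp_pos _) h6
  rw [Real.log_exp] at h7
  linarith

/-- The annihilator of the large spectrum has small codimension. -/
theorem exists_submodule_annihilator (ψ : AddChar F ℂ) (hψ : ψ ≠ 1)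
    (T : Finset (Fin n → F)) (hT : T.Nonempty) :
    ∃ W : Submodule F (Fin n → F),
      (∀ w ∈ W, ∀ v : Fin n → F, 1 / 2 ≤ ‖∑ t ∈ T, ψ (v ⬝ᵥ t)‖ / T.card → v ⬝ᵥ w = 0) ∧
      (n : ℝ) - Module.finrank F W ≤ 8 * Real.log (Fintype.card (Fin n → F) / T.card) := by
  obtain ⟨b, hbs, hspan, hlin⟩ := exists_linearIndependent F
    {v : Fin n → F | 1 / 2 ≤ ‖∑ t ∈ T, ψ (v ⬝ᵥ t)‖ / T.card}
  have hch := chang ψ hψ T hT (fun i : b => (i : Fin n → F)) hlin fun i => hbs i.2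
  set L := Matrix.mulVecLin (Matrix.of fun i : b => (i : Fin n → F)) with hL
  refine ⟨LinearMap.ker L, ?_, ?_⟩
  · intro w hw v hv
    have hv' : v ∈ Submodule.span F b := hspan ▸ Submodule.subset_span hv
    clear hv
    induction hv' using Submodule.span_induction with
    | mem x hx => exact congrFun (LinearMap.mem_ker.1 hw) ⟨x, hx⟩
    | zero => simp
    | add x y _ _ hx hy => rw [add_dotProduct, hx, hy, add_zero]
    | smul a x _ hx => rw [smul_dotProduct, hx, smul_zero]
  · refine le_trans ?_ hch
    have h1 := LinearMap.finrank_range_add_finrank_ker L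
    have h2 := Submodule.finrank_le (LinearMap.range L)
    rw [Module.finrank_fintype_fun_eq_card] at h1 h2
    rw [Fintype.card_fin] at h1
    have h3 : (n : ℝ) ≤ Fintype.card b + Module.finrank F (LinearMap.ker L) := by
      exact_mod_cast (by omega : n ≤ Fintype.card b + Module.finrank F (LinearMap.ker L))
    linarith

end Fourier

/-- A subspace of bounded codimension of almost periods of `f` averaged over `A - C`. -/
theorem exists_submodule_almost_periods {F : Type*} [Field F] [Fintype F] {n : ℕ}
    (A C : Finset (Fin n → F)) (hA : A.Nonempty) (hC : C.Nonempty) (f : (Fin n → F) → ℝ)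
    (hf0 : ∀ x, 0 ≤ f x) (hf1 : ∀ x, f x ≤ 1) (l M : ℕ) (hM : 1 ≤ M) (δ : ℝ) (hδ : 0 ≤ δ) :
    ∃ W : Submodule F (Fin n → F),
      (n : ℝ) - Module.finrank F W ≤
        8 * (Real.log 2 + M * Real.log (Fintype.card (Fin n → F) / A.card)) ∧
      ∀ w ∈ W, (∑ c ∈ C, (∑ a ∈ A, f (a - c)) / A.card) / C.card -
        (2 * l * (2 * δ + 8 * Real.exp (-(δ ^ 2 * M / 2)) * (Fintype.card (Fin n → F) / C.card)) +
          2 * (1 / 2) ^ (2 * l) * √(Fintype.card (Fin n → F) / C.card)) ≤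
        (∑ c ∈ C, (∑ a ∈ A, f (a - (c + w))) / A.card) / C.card := by
  have hA0 : (0:ℝ) < A.card := by exact_mod_cast hA.card_pos
  have hC0 : (0:ℝ) < C.card := by exact_mod_cast hC.card_pos
  have hN0 : (0:ℝ) < Fintype.card (Fin n → F) := by exact_mod_cast Fintype.card_pos
  obtain ⟨ψ, hψ⟩ : ∃ ψ : AddChar F ℂ, ψ ≠ 1 := by
    obtain ⟨ψ, hψ⟩ := AddChar.exists_apply_ne_zero.2 (one_ne_zero (α := F))
    exact ⟨ψ, fun h => hψ (by simp [h])⟩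
  obtain ⟨T, g, hTc, hTg⟩ := exists_croot_sisask A hA f hf0 hf1 M hM δ hδ
  have hT0 : (0:ℝ) < T.card := by
    have : (0:ℝ) < 2 * T.card * (Fintype.card (Fin n → F) : ℝ) ^ M :=
      lt_of_lt_of_le (by positivity) hTc
    by_contra h
    have h0 : (T.card : ℝ) = 0 := le_antisymm (not_lt.1 h) (Nat.cast_nonneg _)
    rw [h0] at this
    simp at this
  have hT : T.Nonempty := Finset.card_pos.1 (by exact_mod_cast hT0)
  set Fa : (Fin n → F) → ℝ := fun y => (∑ a ∈ A, f (a - y)) / A.card with hFa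
  have hF0 : ∀ y, 0 ≤ Fa y := fun y =>
    div_nonneg (Finset.sum_nonneg fun _ _ => hf0 _) hA0.le
  have hF1 : ∀ y, Fa y ≤ 1 := fun y => by
    rw [hFa, div_le_one hA0]
    calc ∑ a ∈ A, f (a - y) ≤ ∑ a ∈ A, 1 := Finset.sum_le_sum fun _ _ => hf1 _
      _ = _ := by simp
  set Φ : (Fin n → F) → ℝ := fun z => (∑ c ∈ C, Fa (c + z)) / C.card with hΦ
  have hstep := abs_avg_translate_sub_le C T hC Fa g hF0 hF1 δ _ hδ hTg
  have hiter := abs_iterate_avgDiff_sub_le T hT Φ _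
    (fun t ht t' ht' z => hstep t ht t' ht' z) l
  obtain ⟨a, ha, hasum⟩ := exists_fourier_expansion ψ hψ C hC Fa hF0 hF1
  obtain ⟨W, hW, hWdim⟩ := exists_submodule_annihilator ψ hψ T hT
  refine ⟨W, hWdim.trans ?_, ?_⟩
  · gcongr
    have h1 : (Fintype.card (Fin n → F) : ℝ) / T.card ≤
        2 * (Fintype.card (Fin n → F) / A.card) ^ M := by
      rw [div_pow, ← mul_div_assoc, div_le_div_iff₀ hT0 (by positivity)]
      linarith
    have h2 := Real.log_le_log (by positivity) h1
    rwa [Real.log_mul (by norm_num) (by positivity), Real.log_pow] at h2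
  · intro w hw
    have h1 := abs_iterate_avgDiff_translate_le ψ T Φ a ha l w fun v hv => hW w hw v hv
    have h2 : ∑ v, ‖a v‖ ≤ √(Fintype.card (Fin n → F) / C.card) := Real.le_sqrt_of_sq_le hasum
    have h3 : 2 * (1 / 2 : ℝ) ^ (2 * l) * ∑ v, ‖a v‖ ≤
      2 * (1 / 2) ^ (2 * l) * √(Fintype.card (Fin n → F) / C.card) := by gcongr
    have h4 := (abs_le.1 (hiter w)).2
    have h5 := (abs_le.1 (hiter 0)).1
    have h6 := (abs_le.1 h1).1
    have h7 : Φ 0 = (∑ c ∈ C, (∑ a ∈ A, f (a - c)) / A.card) / C.card := by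
      simp [hΦ, hFa]
    change _ ≤ Φ w
    rw [← h7]
    have h8 : 2 * l * (2 * δ + 8 * Real.exp (-(δ ^ 2 * M / 2)) *
        (Fintype.card (Fin n → F) / C.card)) = 2 * (l * (2 * δ +
        2 * (4 * Real.exp (-(δ ^ 2 * M / 2)) * Fintype.card (Fin n → F)) / C.card)) := by ring
    rw [h8]
    linarith

/-- Dependent random choice: intersections of `p` random translates of `A` and of `C`, averaged
against a function of the difference. -/
theorem sum_inter_translates {G : Type*} [AddCommGroup G] [Fintype G] (A C : Finset G) (p : ℕ)
    (h : G → ℝ) :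
    ∑ s : Fin p → G, ∑ a ∈ Finset.univ.filter fun y => ∀ i, y + s i ∈ A,
      ∑ c ∈ Finset.univ.filter fun y => ∀ i, y + s i ∈ C, h (a - c) =
    Fintype.card G * ∑ x, h x * ((C.filter fun c => x + c ∈ A).card : ℝ) ^ p := by
  have hind : ∀ (B : Finset G) (s : Fin p → G) (y : G),
      (if ∀ i, y + s i ∈ B then (1:ℝ) else 0) = ∏ i, if y + s i ∈ B then (1:ℝ) else 0 := by
    intro B s y
    rw [Finset.prod_ite_zero]
    simp
  have h1 : ∀ s : Fin p → G, ∑ a ∈ Finset.univ.filter fun y => ∀ i, y + s i ∈ A,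
      ∑ c ∈ Finset.univ.filter fun y => ∀ i, y + s i ∈ C, h (a - c) =
      ∑ a, ∑ c, h (a - c) * ∏ i, ((if a + s i ∈ A then (1:ℝ) else 0) *
        if c + s i ∈ C then (1:ℝ) else 0) := by
    intro s
    rw [Finset.sum_filter]
    refine Finset.sum_congr rfl fun a _ => ?_
    simp_rw [Finset.prod_mul_distrib, ← hind]
    rw [Finset.sum_filter]
    split_ifs <;> simp
  have h2 : ∀ a c : G, ∑ s : Fin p → G, h (a - c) * ∏ i, ((if a + s i ∈ A then (1:ℝ) else 0) *
        if c + s i ∈ C then (1:ℝ) else 0) =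
      h (a - c) * ((C.filter fun c' => a - c + c' ∈ A).card : ℝ) ^ p := by
    intro a c
    rw [← Finset.mul_sum, ← Fintype.sum_pow
      (fun s => (if a + s ∈ A then (1:ℝ) else 0) * if c + s ∈ C then (1:ℝ) else 0)]
    congr 2
    rw [← Equiv.sum_comp (Equiv.subRight c)]
    simp only [Equiv.subRight_apply, add_sub_cancel, ← ite_and, mul_ite, mul_one, mul_zero]
    rw [← Finset.sum_filter, Finset.sum_const, nsmul_one]
    congr 2
    ext x
    simp [add_sub, sub_add_eq_add_sub]
  simp_rw [h1]
  rw [Finset.sum_comm]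
  have h3 : ∀ a : G, ∑ s : Fin p → G, ∑ c, h (a - c) * ∏ i,
      ((if a + s i ∈ A then (1:ℝ) else 0) * if c + s i ∈ C then (1:ℝ) else 0) =
      ∑ x, h x * ((C.filter fun c => x + c ∈ A).card : ℝ) ^ p := by
    intro a
    rw [Finset.sum_comm]
    simp_rw [h2]
    exact Equiv.sum_comp (Equiv.subLeft a)
      fun x => h x * ((C.filter fun c => x + c ∈ A).card : ℝ) ^ p
  rw [Finset.sum_congr rfl fun a _ => h3 a]
  simp

theorem sum_card_inter_translates {G : Type*} [AddCommGroup G] [Fintype G] (A : Finset G)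
    (p : ℕ) :
    ∑ s : Fin p → G, ((Finset.univ.filter fun y => ∀ i, y + s i ∈ A).card : ℝ) =
      Fintype.card G * (A.card : ℝ) ^ p := by
  have hind : ∀ (s : Fin p → G) (y : G),
      (if ∀ i, y + s i ∈ A then (1:ℝ) else 0) = ∏ i, if y + s i ∈ A then (1:ℝ) else 0 := by
    intro s y
    rw [Finset.prod_ite_zero]
    simp
  have h1 : ∀ s : Fin p → G, ((Finset.univ.filter fun y => ∀ i, y + s i ∈ A).card : ℝ) =
      ∑ y, ∏ i, if y + s i ∈ A then (1:ℝ) else 0 := by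
    intro s
    simp_rw [← hind]
    simp
  simp_rw [h1]
  rw [Finset.sum_comm]
  have h2 : ∀ y : G, ∑ s : Fin p → G, ∏ i, (if y + s i ∈ A then (1:ℝ) else 0) =
      (A.card : ℝ) ^ p := by
    intro y
    rw [← Fintype.sum_pow (fun s => if y + s ∈ A then (1:ℝ) else 0),
      ← Equiv.sum_comp (Equiv.subRight y)]
    simp
  rw [Finset.sum_congr rfl fun y _ => h2 y]
  simp

theorem exists_sift {G : Type*} [AddCommGroup G] [Fintype G] (A C : Finset G) (p : ℕ)
    (ρ η α γ R : ℝ) (hρ : 0 ≤ ρ) (hη : 0 < η) (hα : 0 ≤ α) (hγ : 0 ≤ γ) (hR0 : 0 < R)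
    (hR : R ≤ ∑ x, ((C.filter fun c => x + c ∈ A).card : ℝ) ^ p)
    (hbad : Fintype.card G * ρ ^ p ≤ η / 4 * R)
    (hAα : α * Fintype.card G * (C.card : ℝ) ^ p ≤ R / 4)
    (hCγ : γ * Fintype.card G * (A.card : ℝ) ^ p ≤ R / 4) :
    ∃ A' C' : Finset G, A'.Nonempty ∧ C'.Nonempty ∧ α * Fintype.card G ≤ A'.card ∧
      γ * Fintype.card G ≤ C'.card ∧
      (1 - η) * (A'.card * C'.card) ≤ ∑ c ∈ C', ∑ a ∈ A',
        if ρ < ((C.filter fun c' => a - c + c' ∈ A).card : ℝ) then (1:ℝ) else 0 := by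
  have hN0 : (0:ℝ) < Fintype.card G := by exact_mod_cast Fintype.card_pos
  set r : G → ℝ := fun x => ((C.filter fun c => x + c ∈ A).card : ℝ) with hr
  set A' : (Fin p → G) → Finset G := fun s => Finset.univ.filter fun y => ∀ i, y + s i ∈ A
  set C' : (Fin p → G) → Finset G := fun s => Finset.univ.filter fun y => ∀ i, y + s i ∈ C
  set bad : (Fin p → G) → ℝ := fun s => ∑ a ∈ A' s, ∑ c ∈ C' s, if r (a - c) ≤ ρ then 1 else 0
    with hbaddef
  have htot : ∑ s, ((A' s).card : ℝ) * (C' s).card = Fintype.card G * ∑ x, r x ^ p := by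
    have := sum_inter_translates A C p fun _ => 1
    simpa [A', C', r] using this
  have hbadsum : ∑ s, bad s ≤ Fintype.card G * (Fintype.card G * ρ ^ p) := by
    rw [hbaddef]
    simp only
    rw [sum_inter_translates A C p fun x => if r x ≤ ρ then 1 else 0]
    gcongr
    calc _ ≤ ∑ x : G, ρ ^ p := by
          refine Finset.sum_le_sum fun x _ => ?_
          split_ifs with hx
          · rw [one_mul]; exact pow_le_pow_left₀ (Nat.cast_nonneg _) hx p
          · rw [zero_mul]; positivity
      _ = _ := by simp
  have hAsum : ∑ s, ((A' s).card : ℝ) = Fintype.card G * (A.card : ℝ) ^ p :=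
    sum_card_inter_translates A p
  have hCsum : ∑ s, ((C' s).card : ℝ) = Fintype.card G * (C.card : ℝ) ^ p :=
    sum_card_inter_translates C p
  obtain ⟨s, hs⟩ : ∃ s, bad s / η + α * Fintype.card G * (C' s).card +
      γ * Fintype.card G * (A' s).card < ((A' s).card : ℝ) * (C' s).card := by
    by_contra! hcon
    have h1 := Finset.sum_le_sum fun s (_ : s ∈ Finset.univ) => hcon s
    rw [Finset.sum_add_distrib, Finset.sum_add_distrib, ← Finset.sum_div, ← Finset.mul_sum,
      ← Finset.mul_sum, htot, hAsum, hCsum] at h1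
    have h2 : (∑ s, bad s) / η ≤ Fintype.card G * (R / 4) := by
      rw [div_le_iff₀ hη]
      calc _ ≤ _ := hbadsum
        _ ≤ Fintype.card G * (η / 4 * R) := by gcongr
        _ = _ := by ring
    have h3 : α * Fintype.card G * (Fintype.card G * (C.card : ℝ) ^ p) ≤
        Fintype.card G * (R / 4) := by
      calc _ = Fintype.card G * (α * Fintype.card G * (C.card : ℝ) ^ p) := by ring
        _ ≤ _ := by gcongr
    have h4 : γ * Fintype.card G * (Fintype.card G * (A.card : ℝ) ^ p) ≤
        Fintype.card G * (R / 4) := by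
      calc _ = Fintype.card G * (γ * Fintype.card G * (A.card : ℝ) ^ p) := by ring
        _ ≤ _ := by gcongr
    have h5 : Fintype.card G * R ≤ Fintype.card G * ∑ x, r x ^ p := by gcongr
    have h6 : 0 < Fintype.card G * R := by positivity
    linarith
  have hb0 : 0 ≤ bad s := Finset.sum_nonneg fun _ _ => Finset.sum_nonneg fun _ _ => by
    split_ifs <;> norm_num
  have hb0' : 0 ≤ bad s / η := by positivity
  have hA0 : (0:ℝ) ≤ (A' s).card := Nat.cast_nonneg _
  have hC0 : (0:ℝ) ≤ (C' s).card := Nat.cast_nonneg _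
  have hαC : 0 ≤ α * Fintype.card G * (C' s).card := by positivity
  have hγA : 0 ≤ γ * Fintype.card G * (A' s).card := by positivity
  have hpos : (0:ℝ) < (A' s).card * (C' s).card := by linarith
  have hA1 : (0:ℝ) < (A' s).card := pos_of_mul_pos_left hpos hC0
  have hC1 : (0:ℝ) < (C' s).card := pos_of_mul_pos_right hpos hA0
  refine ⟨A' s, C' s, Finset.card_pos.1 (by exact_mod_cast hA1),
    Finset.card_pos.1 (by exact_mod_cast hC1), ?_, ?_, ?_⟩
  · exact (lt_of_mul_lt_mul_right (by linarith : _ < ((A' s).card : ℝ) * (C' s).card) hC0).le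
  · refine (lt_of_mul_lt_mul_right (a := ((A' s).card : ℝ)) ?_ hA0).le
    linarith
  · have h1 : bad s ≤ η * ((A' s).card * (C' s).card) := by
      rw [← div_le_iff₀' hη]; linarith
    have h2 : bad s + ∑ c ∈ C' s, ∑ a ∈ A' s, (if ρ < r (a - c) then (1:ℝ) else 0) =
        (A' s).card * (C' s).card := by
      rw [hbaddef]
      simp only
      rw [Finset.sum_comm, ← Finset.sum_add_distrib]
      simp_rw [← Finset.sum_add_distrib]
      have : ∀ x, (if r x ≤ ρ then (1:ℝ) else 0) + (if ρ < r x then 1 else 0) = 1 := by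
        intro x
        by_cases hx : r x ≤ ρ
        · simp [hx, not_lt.2 hx]
        · simp [hx, not_le.1 hx]
      simp_rw [this]
      simp [mul_comm]
    change _ ≤ ∑ c ∈ C' s, ∑ a ∈ A' s, (if ρ < r (a - c) then (1:ℝ) else 0)
    linarith

/-- Hölder's inequality for the representation function restricted to `B`. -/
theorem le_sum_card_filter_pow {G : Type*} [AddCommGroup G] [Fintype G] (A B C : Finset G)
    (hB : B.Nonempty) (m : ℝ) (hm : 0 ≤ m)
    (h : m * B.card ≤ ∑ b ∈ B, ((C.filter fun c => b + c ∈ A).card : ℝ)) (p : ℕ) (hp : p ≠ 0) :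
    B.card * m ^ p ≤ ∑ x, ((C.filter fun c => x + c ∈ A).card : ℝ) ^ p := by
  obtain ⟨p, rfl⟩ := Nat.exists_eq_succ_of_ne_zero hp
  have hB0 : (0:ℝ) < B.card := by exact_mod_cast hB.card_pos
  calc (B.card : ℝ) * m ^ (p + 1) = (m * B.card) ^ (p + 1) / (B.card : ℝ) ^ p := by
        field_simp
        ring
    _ ≤ (∑ b ∈ B, ((C.filter fun c => b + c ∈ A).card : ℝ)) ^ (p + 1) / (B.card : ℝ) ^ p := by
        gcongr
    _ ≤ ∑ b ∈ B, ((C.filter fun c => b + c ∈ A).card : ℝ) ^ (p + 1) :=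
        pow_sum_div_card_le_sum_pow (fun _ _ => Nat.cast_nonneg _) p
    _ ≤ _ := Finset.sum_le_sum_of_subset_of_nonneg (Finset.subset_univ _)
        fun _ _ _ => by positivity

/-- A lower bound for averages along `W` of popular differences gives a dense translate of `W`. -/
theorem exists_translate_of_average {F : Type*} [Field F] {V : Type*}
    [AddCommGroup V] [Module F V] [Fintype V]
    (A C A' C' : Finset V) (hC : C.Nonempty) (hA' : A'.Nonempty) (hC' : C'.Nonempty)
    (W : Submodule F V) (ρ β Q : ℝ) (hρ : 0 ≤ ρ) (hQ : Q * C.card ≤ β * ρ)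
    (h : ∀ w ∈ W, β ≤ (∑ c ∈ C', (∑ a ∈ A',
      if ρ < ((C.filter fun c' => a - (c + w) + c' ∈ A).card : ℝ) then (1:ℝ) else 0) / A'.card) /
        C'.card) :
    ∃ θ : V, Q * Nat.card W ≤ ((A.filter fun x => x - θ ∈ W).card : ℝ) := by
  have hA0 : (0:ℝ) < A'.card := by exact_mod_cast hA'.card_pos
  have hC0 : (0:ℝ) < C'.card := by exact_mod_cast hC'.card_pos
  set WF : Finset V := Finset.univ.filter fun w => w ∈ W with hWF
  have hWc : (Nat.card W : ℝ) = WF.card := by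
    rw [Nat.card_eq_fintype_card, Fintype.card_subtype]
  have hcount : ∀ θ, ((A.filter fun x => x - θ ∈ W).card : ℝ) =
      ∑ w ∈ WF, if θ - w ∈ A then (1:ℝ) else 0 := by
    intro θ
    rw [← Finset.sum_filter, Finset.sum_const, nsmul_one]
    norm_cast
    refine Finset.card_nbij' (fun x => θ - x) (fun w => θ - w) ?_ ?_ ?_ ?_
    · intro x hx
      have hx := Finset.mem_filter.1 hx
      simp only [hWF, Finset.coe_filter, Finset.mem_filter, Finset.mem_univ, true_and,
        Set.mem_ofPred_eq, sub_sub_cancel]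
      exact ⟨by simpa using W.neg_mem hx.2, hx.1⟩
    · intro w hw
      have hw := Finset.mem_filter.1 hw
      simp only [Finset.coe_filter, Set.mem_ofPred_eq]
      refine ⟨hw.2, ?_⟩
      have := W.neg_mem (Finset.mem_filter.1 hw.1).2
      simpa using this
    · intro x _; simp
    · intro x _; simp
  have hw : ∀ w ∈ WF, β * ρ * (A'.card * C'.card) ≤ ∑ c ∈ C', ∑ a ∈ A', ∑ c' ∈ C,
      if a - (c + w) + c' ∈ A then (1:ℝ) else 0 := by
    intro w hw
    have h1 := h w (Finset.mem_filter.1 hw).2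
    rw [← Finset.sum_div, le_div_iff₀ hC0, le_div_iff₀ hA0] at h1
    calc _ = ρ * (β * C'.card * A'.card) := by ring
      _ ≤ ρ * ∑ c ∈ C', ∑ a ∈ A',
          if ρ < ((C.filter fun c' => a - (c + w) + c' ∈ A).card : ℝ) then (1:ℝ) else 0 := by
        gcongr
      _ ≤ _ := by
        simp_rw [Finset.mul_sum]
        refine Finset.sum_le_sum fun c _ => Finset.sum_le_sum fun a _ => ?_
        rw [← Finset.sum_filter, Finset.sum_const, nsmul_one]
        split_ifs with hx
        · rw [mul_one]; exact hx.le
        · rw [mul_zero]; positivity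
  obtain ⟨x, -, hx⟩ : ∃ x ∈ C' ×ˢ (A' ×ˢ C), Q * Nat.card W ≤
      ((A.filter fun y => y - (x.2.1 - x.1 + x.2.2) ∈ W).card : ℝ) := by
    refine Finset.exists_le_of_sum_le (hC'.product (hA'.product hC)) ?_
    simp_rw [hcount]
    rw [Finset.sum_const, Finset.card_product, Finset.card_product, nsmul_eq_mul,
      Finset.sum_comm, hWc]
    push_cast
    calc _ = WF.card * (Q * C.card * (A'.card * C'.card)) := by ring
      _ ≤ WF.card * (β * ρ * (A'.card * C'.card)) := by gcongr
      _ ≤ _ := by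
        rw [← nsmul_eq_mul]
        refine Finset.card_nsmul_le_sum _ _ _ fun w hwW => (hw w hwW).trans (le_of_eq ?_)
        rw [Finset.sum_product]
        simp_rw [Finset.sum_product]
        refine Finset.sum_congr rfl fun c _ => Finset.sum_congr rfl fun a _ =>
          Finset.sum_congr rfl fun c' _ => ?_
        rw [show a - (c + w) + c' = a - c + c' - w by abel]
  exact ⟨_, hx⟩

theorem pow_gap (k p : ℕ) (hk : 1 ≤ k) (ε : ℝ) (hε : 0 < ε) (hε1 : ε ≤ 1)
    (hp : 16 * (k + Real.log (2 / ε)) / ε ≤ p) :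
    (1 + ε / 2) ^ p * (2 ^ k * (128 / ε)) ≤ (1 + ε) ^ p := by
  have hk' : (1:ℝ) ≤ k := by exact_mod_cast hk
  have h2ε : 2 ≤ 2 / ε := by rw [le_div_iff₀ hε]; linarith
  have h1 : (1 + ε / 2) * Real.exp (ε / 4) ≤ 1 + ε := by
    have h := Real.add_one_le_exp (-(ε / 4))
    have h3 : (1 - ε / 4) * Real.exp (ε / 4) ≤ 1 := by
      calc _ ≤ Real.exp (-(ε / 4)) * Real.exp (ε / 4) := by gcongr; linarith
        _ = 1 := by rw [← Real.exp_add]; simp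
    have h4 : 1 + ε / 2 ≤ (1 + ε) * (1 - ε / 4) := by nlinarith
    calc _ ≤ (1 + ε) * (1 - ε / 4) * Real.exp (ε / 4) := by gcongr
      _ = (1 + ε) * ((1 - ε / 4) * Real.exp (ε / 4)) := by ring
      _ ≤ (1 + ε) * 1 := by gcongr
      _ = _ := by ring
  have h2 : 2 ^ k * (128 / ε) ≤ Real.exp (ε / 4) ^ p := by
    rw [← Real.exp_nat_mul]
    have h3 : 4 * (k : ℝ) + 4 * Real.log (2 / ε) ≤ p * (ε / 4) := by
      rw [div_le_iff₀ hε] at hp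
      linarith
    have he : (2:ℝ) ≤ Real.exp 1 := by have := Real.add_one_le_exp (1:ℝ); linarith
    have h4 : (2:ℝ) ^ k * 8 ≤ Real.exp (4 * k) := by
      calc (2:ℝ) ^ k * 8 = 2 ^ k * 2 ^ (3 * 1) := by norm_num
        _ ≤ 2 ^ k * 2 ^ (3 * k) := by gcongr; norm_num
        _ = 2 ^ (4 * k) := by rw [← pow_add]; ring_nf
        _ ≤ Real.exp 1 ^ (4 * k) := by gcongr
        _ = _ := by rw [← Real.exp_nat_mul]; push_cast; ring_nf
    have h5 : 16 / ε ≤ Real.exp (4 * Real.log (2 / ε)) := by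
      have : Real.exp (4 * Real.log (2 / ε)) = (2 / ε) ^ 4 := by
        rw [← Real.log_rpow (by linarith), Real.exp_log (by positivity)]
        norm_cast
      rw [this]
      calc 16 / ε = 2 ^ 3 * (2 / ε) := by ring
        _ ≤ (2 / ε) ^ 3 * (2 / ε) := by gcongr
        _ = _ := by ring
    calc (2:ℝ) ^ k * (128 / ε) = (2 ^ k * 8) * (16 / ε) := by ring
      _ ≤ Real.exp (4 * k) * Real.exp (4 * Real.log (2 / ε)) := by gcongr
      _ = Real.exp (4 * k + 4 * Real.log (2 / ε)) := by rw [Real.exp_add]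
      _ ≤ _ := Real.exp_le_exp.2 h3
  calc _ ≤ (1 + ε / 2) ^ p * Real.exp (ε / 4) ^ p := by gcongr
    _ = ((1 + ε / 2) * Real.exp (ε / 4)) ^ p := by rw [mul_pow]
    _ ≤ _ := by gcongr

theorem le_two_pow_of_le (k p : ℕ) (hk : 1 ≤ k) (ε : ℝ) (hε : 0 < ε) (hε1 : ε ≤ 1)
    (hp : 16 * (k + Real.log (2 / ε)) / ε ≤ p) : 128 / ε ≤ 2 ^ p := by
  have hk' : (1:ℝ) ≤ k := by exact_mod_cast hk
  have h2ε : 2 ≤ 2 / ε := by rw [le_div_iff₀ hε]; linarith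
  have hL : 0 ≤ Real.log (2 / ε) := Real.log_nonneg (by linarith)
  have h1 : 16 + 16 * Real.log (2 / ε) ≤ p := by
    refine le_trans ?_ hp
    rw [le_div_iff₀ hε]
    nlinarith
  have h2 : Real.exp (1 / 2) ≤ 2 := by
    have h3 := Real.exp_one_lt_d9
    have h4 : Real.exp (1 / 2) ^ 2 = Real.exp 1 := by rw [← Real.exp_nat_mul]; norm_num
    nlinarith [Real.exp_pos (1 / 2)]
  have he : (2:ℝ) ≤ Real.exp 1 := by have := Real.add_one_le_exp (1:ℝ); linarith
  calc 128 / ε ≤ 2 ^ 8 * (2 / ε) := by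
        rw [mul_div_assoc', div_le_div_iff_of_pos_right hε]; norm_num
    _ ≤ Real.exp 1 ^ 8 * Real.exp (Real.log (2 / ε)) := by
        rw [Real.exp_log (by linarith)]; gcongr
    _ = Real.exp (8 + Real.log (2 / ε)) := by rw [Real.exp_add, ← Real.exp_nat_mul]; norm_num
    _ ≤ Real.exp (p * (1 / 2)) := Real.exp_le_exp.2 (by linarith)
    _ = Real.exp (1 / 2) ^ p := by rw [Real.exp_nat_mul]
    _ ≤ _ := by gcongr

/-- The error terms of the almost-periodicity step, `x` being an inverse density. -/
theorem almost_period_error_le (l M : ℕ) (hl : 16 ≤ l) (ε x : ℝ) (hε : 0 < ε) (hx0 : 0 ≤ x)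
    (hl2 : 128 / ε ≤ 2 ^ l) (hM : 2 ^ 17 * (l:ℝ) ^ 3 / ε ^ 2 ≤ M) (hx : x ≤ 4 * 2 ^ l) :
    2 * l * (2 * (ε / (128 * l)) + 8 * Real.exp (-((ε / (128 * l)) ^ 2 * M / 2)) * x) +
      2 * (1 / 2) ^ (2 * l) * √x ≤ 3 * ε / 32 := by
  have hl' : (16:ℝ) ≤ l := by exact_mod_cast hl
  have h2l : (0:ℝ) < 2 ^ l := by positivity
  have hlε : 128 ≤ 2 ^ l * ε := by rwa [div_le_iff₀ hε] at hl2
  have hl11 : (2:ℝ) ^ 11 ≤ 2 ^ l := pow_le_pow_right₀ (by norm_num) (by omega)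
  have hll : (l:ℝ) ≤ 2 ^ l := by exact_mod_cast (Nat.lt_two_pow_self (n := l)).le
  have hexp : Real.exp (-((ε / (128 * l)) ^ 2 * M / 2)) ≤ 1 / (2 ^ l) ^ 4 := by
    have h1 : 4 * (l:ℝ) ≤ (ε / (128 * l)) ^ 2 * M / 2 := by
      calc 4 * (l:ℝ) = (ε / (128 * l)) ^ 2 * (2 ^ 17 * (l:ℝ) ^ 3 / ε ^ 2) / 2 := by
            field_simp; norm_num
        _ ≤ _ := by gcongr
    rw [Real.exp_neg, ← one_div]
    gcongr
    calc ((2:ℝ) ^ l) ^ 4 ≤ (Real.exp 1 ^ l) ^ 4 := by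
          gcongr; have := Real.add_one_le_exp (1:ℝ); linarith
      _ = Real.exp (4 * l) := by rw [← pow_mul, ← Real.exp_nat_mul]; push_cast; ring_nf
      _ ≤ _ := Real.exp_le_exp.2 h1
  have hsqrt : √x ≤ 2 * 2 ^ l := by
    rw [Real.sqrt_le_left (by positivity)]
    nlinarith
  have h1 : 2 * (1 / 2 : ℝ) ^ (2 * l) * √x ≤ ε / 32 := by
    calc _ ≤ 2 * (1 / 2 : ℝ) ^ (2 * l) * (2 * 2 ^ l) := by gcongr
      _ = 4 / 2 ^ l := by rw [pow_mul', div_pow, one_pow]; field_simp; ring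
      _ ≤ _ := by rw [div_le_div_iff₀ h2l (by norm_num)]; linarith
  have h2 : 8 * Real.exp (-((ε / (128 * l)) ^ 2 * M / 2)) * x ≤ 32 / (2 ^ l) ^ 3 := by
    calc _ ≤ 8 * (1 / ((2:ℝ) ^ l) ^ 4) * (4 * 2 ^ l) := by gcongr
      _ = _ := by field_simp; norm_num
  have h3 : 2 * (l:ℝ) * (32 / (2 ^ l) ^ 3) ≤ ε / 32 := by
    calc _ ≤ 2 * ((2:ℝ) ^ l) * (32 / (2 ^ l) ^ 3) := by gcongr
      _ = 64 / (2:ℝ) ^ l / 2 ^ l := by field_simp; norm_num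
      _ ≤ 64 / (2:ℝ) ^ l / 2 ^ 11 := by gcongr
      _ = 1 / (2:ℝ) ^ l / 32 := by field_simp; norm_num
      _ ≤ ε / 32 := by
        gcongr
        rw [div_le_iff₀ h2l]; linarith
  have h4 : 2 * (l:ℝ) * (2 * (ε / (128 * l))) = ε / 32 := by field_simp; norm_num
  have h5 := mul_le_mul_of_nonneg_left h2 (by positivity : (0:ℝ) ≤ 2 * l)
  linarith

theorem codim_bound (k p M : ℕ) (hk : 1 ≤ k) (d ε L : ℝ) (hd : 1 ≤ d) (hε : 0 < ε)
    (hL : 0 ≤ L) (hp16 : 16 ≤ p) (hp : (p:ℝ) ≤ 17 * (k + L) / ε)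
    (hM1 : 1 ≤ M) (hM : (M:ℝ) ≤ 2 ^ 18 * ((k * p : ℕ) : ℝ) ^ 3 / ε ^ 2) (y : ℝ) (hy0 : 0 < y)
    (hy : y ≤ 4 * (2:ℝ) ^ (d * p)) :
    8 * (Real.log 2 + M * Real.log y) ≤
      24 * 2 ^ 18 * 17 ^ 4 * 8 * (d * k ^ 7 / ε ^ 6 + d * k ^ 3 * L ^ 4 / ε ^ 6) := by
  have hp16' : (16:ℝ) ≤ p := by exact_mod_cast hp16
  have hM1' : (1:ℝ) ≤ M := by exact_mod_cast hM1
  have hdp : 16 ≤ d * p := by nlinarith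
  have hlog2 : Real.log 2 ≤ 1 := by have := Real.log_two_lt_d9; linarith
  have hlog20 : 0 ≤ Real.log 2 := Real.log_nonneg (by norm_num)
  have hlog : Real.log y ≤ 2 * (d * p) := by
    calc Real.log y ≤ Real.log (4 * (2:ℝ) ^ (d * p)) := Real.log_le_log hy0 hy
      _ = (2 + d * p) * Real.log 2 := by
        rw [Real.log_mul (by norm_num) (by positivity), Real.log_rpow (by norm_num),
          show (4:ℝ) = 2 ^ 2 by norm_num, Real.log_pow]
        push_cast; ring
      _ ≤ (2 + d * p) * 1 := by gcongr
      _ ≤ _ := by linarith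
  have h1 : 8 * (Real.log 2 + M * Real.log y) ≤ 24 * (M * (d * p)) := by
    have h2 : (M:ℝ) * Real.log y ≤ M * (2 * (d * p)) := by gcongr
    have h3 : 1 ≤ (M:ℝ) * (d * p) := by nlinarith
    linarith
  have h4 : (k + L) ^ 4 ≤ 8 * ((k:ℝ) ^ 4 + L ^ 4) := by
    have h5 : ((k:ℝ) + L) ^ 2 ≤ 2 * (k ^ 2 + L ^ 2) := by nlinarith [sq_nonneg ((k:ℝ) - L)]
    have h6 : (((k:ℝ) + L) ^ 2) ^ 2 ≤ (2 * (k ^ 2 + L ^ 2)) ^ 2 := by gcongr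
    nlinarith [sq_nonneg ((k:ℝ) ^ 2 - L ^ 2)]
  refine h1.trans ?_
  calc 24 * (M * (d * p)) ≤ 24 * (2 ^ 18 * ((k * p : ℕ) : ℝ) ^ 3 / ε ^ 2 * (d * p)) := by gcongr
    _ = 24 * 2 ^ 18 * (d * k ^ 3 / ε ^ 2) * (p:ℝ) ^ 4 := by push_cast; ring
    _ ≤ 24 * 2 ^ 18 * (d * k ^ 3 / ε ^ 2) * (17 * (k + L) / ε) ^ 4 := by gcongr
    _ = 24 * 2 ^ 18 * 17 ^ 4 * (d * k ^ 3 / ε ^ 6) * (k + L) ^ 4 := by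
      field_simp
    _ ≤ 24 * 2 ^ 18 * 17 ^ 4 * (d * k ^ 3 / ε ^ 6) * (8 * ((k:ℝ) ^ 4 + L ^ 4)) := by gcongr
    _ = _ := by ring

/-- `⟨B * C, A⟩` counts the pairs in `B × C` with sum in `A`. -/
theorem inn_convC_dens {G : Type*} [AddCommGroup G] [Fintype G] (A B C : Finset G) :
    inn (convC (dens B) (dens C)) (dens A) =
      Fintype.card G / (A.card * B.card * C.card) *
        ∑ b ∈ B, ((C.filter fun c => b + c ∈ A).card : ℝ) := by
  have hN0 : (Fintype.card G : ℝ) ≠ 0 := by exact_mod_cast Fintype.card_ne_zero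
  have hd : ∀ (D : Finset G) (x : G), dens D x =
      Fintype.card G / D.card * if x ∈ D then 1 else 0 := by
    intro D x
    simp [dens]
  have h1 : ∑ x, (∑ y, (if y ∈ B then (1:ℝ) else 0) * if x - y ∈ C then 1 else 0) *
      (if x ∈ A then 1 else 0) = ∑ b ∈ B, ((C.filter fun c => b + c ∈ A).card : ℝ) := by
    simp_rw [Finset.sum_mul]
    rw [Finset.sum_comm, ← Finset.sum_filter_add_sum_filter_not Finset.univ (· ∈ B)]
    rw [Finset.sum_eq_zero (s := Finset.univ.filter (· ∉ B))]
    · rw [add_zero, Finset.filter_univ_mem]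
      refine Finset.sum_congr rfl fun b hb => ?_
      trans ∑ x, (if x ∈ C then (1:ℝ) else 0) * if b + x ∈ A then 1 else 0
      · exact Fintype.sum_equiv (Equiv.subRight b) _ _ fun x => by simp [hb]
      · simp only [mul_ite, mul_one, mul_zero, ← ite_and]
        rw [← Finset.sum_filter, Finset.sum_const, nsmul_one]
        congr 2
        ext x
        simp [and_comm]
    · intro b hb
      simp [(Finset.mem_filter.1 hb).2]
  rw [← h1, inn]
  simp only [convC, hd]
  rw [Finset.mul_sum, Finset.sum_div]
  refine Finset.sum_congr rfl fun x _ => ?_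
  have h2 : ∑ y, (Fintype.card G : ℝ) / B.card * (if y ∈ B then 1 else 0) *
      (Fintype.card G / C.card * if x - y ∈ C then 1 else 0) =
      Fintype.card G / B.card * (Fintype.card G / C.card) *
        ∑ y, (if y ∈ B then (1:ℝ) else 0) * if x - y ∈ C then 1 else 0 := by
    rw [Finset.mul_sum]
    exact Finset.sum_congr rfl fun y _ => by ring
  rw [h2]
  field_simp

theorem mul_card_le_sum_of_le_inn {G : Type*} [AddCommGroup G] [Fintype G] (A B C : Finset G)
    (hA : A.Nonempty) (hB : B.Nonempty) (hC : C.Nonempty) (N r : ℝ)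
    (hN : (Fintype.card G : ℝ) = N) (h : r ≤ inn (convC (dens B) (dens C)) (dens A)) :
    r * (A.card * C.card / N) * B.card ≤ ∑ b ∈ B, ((C.filter fun c => b + c ∈ A).card : ℝ) := by
  have hN0 : 0 < N := by rw [← hN]; exact_mod_cast Fintype.card_pos_iff.2 ⟨hA.choose⟩
  have hA0 : (0:ℝ) < A.card := by exact_mod_cast hA.card_pos
  have hB0 : (0:ℝ) < B.card := by exact_mod_cast hB.card_pos
  have hC0 : (0:ℝ) < C.card := by exact_mod_cast hC.card_pos
  have h1 := h.trans_eq (inn_convC_dens A B C)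
  generalize ∑ b ∈ B, ((C.filter fun c => b + c ∈ A).card : ℝ) = S at h1 ⊢
  rw [hN, div_mul_eq_mul_div, le_div_iff₀ (by positivity)] at h1
  refine le_of_mul_le_mul_left (le_trans (le_of_eq ?_) h1) hN0
  field_simp

set_option maxHeartbeats 400000 in
/-- Structure vs. pseudorandomness in `𝔽_q^n`: if `⟨B * C′, A⟩ ≥ 1 + ε` for some large
sets `B, C′`, then `A` has a density increment on an affine subspace of bounded
codimension. -/
theorem density_increment_from_star_norm :
    ∃ C : ℝ, 1 ≤ C ∧ ∀ (F : Type) [Field F] [Fintype F] [DecidableEq F] (n : ℕ), 1 ≤ n →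
      ∀ d : ℝ, 1 ≤ d → ∀ A : Finset (Fin n → F), ∀ k : ℕ, 1 ≤ k →
      ∀ ε : ℝ, 0 < ε → ε ≤ 1 →
      (2:ℝ) ^ (-d) * (Fintype.card F : ℝ) ^ n ≤ A.card →
      (∃ B C' : Finset (Fin n → F), B.Nonempty ∧ C'.Nonempty ∧
        (2:ℝ) ^ (-(k:ℝ)) * (Fintype.card F : ℝ) ^ n ≤ B.card ∧
        (2:ℝ) ^ (-(k:ℝ)) * (Fintype.card F : ℝ) ^ n ≤ C'.card ∧
        1 + ε ≤ inn (convC (dens B) (dens C')) (dens A)) →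
      ∃ (W : Submodule F (Fin n → F)) (θ : Fin n → F),
        ((n:ℝ) - Module.finrank F W) ≤
          C * (d * k ^ 7 / ε ^ 6 + d * k ^ 3 * Real.log (2/ε) ^ 4 / ε ^ 6) ∧
        (1 + ε/8) * (A.card : ℝ) * (Nat.card W : ℝ) ≤
          ((A.filter fun x => x - θ ∈ W).card : ℝ) * (Fintype.card F : ℝ) ^ n := by
  refine ⟨24 * 2 ^ 18 * 17 ^ 4 * 8, by norm_num, ?_⟩
  intro F _ _ inst n _ d hd A k hk ε hε hε1 hAd ⟨B, C, hB, hC, hBk, hCk, hinn⟩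
  clear inst
  let : DecidableEq (Fin n → F) := fun a b => Classical.propDecidable (a = b)
  set N : ℝ := (Fintype.card F : ℝ) ^ n with hN
  have hNc : (Fintype.card (Fin n → F) : ℝ) = N := by simp [hN]
  have hN0 : 0 < N := by rw [← hNc]; exact_mod_cast Fintype.card_pos
  have hA0 : (0:ℝ) < A.card := lt_of_lt_of_le (by positivity) hAd
  have hB0 : (0:ℝ) < B.card := lt_of_lt_of_le (by positivity) hBk
  have hC0 : (0:ℝ) < C.card := lt_of_lt_of_le (by positivity) hCk
  have hk' : (1:ℝ) ≤ k := by exact_mod_cast hk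
  have h2ε : 2 ≤ 2 / ε := by rw [le_div_iff₀ hε]; linarith
  set L := Real.log (2 / ε) with hLdef
  have hL : 0 ≤ L := Real.log_nonneg (by linarith)
  set D : ℝ := A.card * C.card / N with hD
  have hD0 : 0 < D := by positivity
  have hbase : 16 ≤ 16 * (k + L) / ε := by
    rw [le_div_iff₀ hε]; nlinarith
  set p : ℕ := ⌈16 * (k + L) / ε⌉₊ with hpdef
  have hp : 16 * (k + L) / ε ≤ p := Nat.le_ceil _
  have hp' : (p:ℝ) ≤ 17 * (k + L) / ε := by
    have h1 := (Nat.ceil_lt_add_one (by linarith : 0 ≤ 16 * (k + L) / ε)).le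
    have h2 : 16 * (k + L) / ε = 16 * ((k + L) / ε) := by ring
    have h3 : 17 * (k + L) / ε = 17 * ((k + L) / ε) := by ring
    rw [← hpdef] at h1
    linarith
  have hp16 : 16 ≤ p := by exact_mod_cast hbase.trans hp
  set l : ℕ := k * p with hl
  have hpl : p ≤ l := Nat.le_mul_of_pos_left p (by omega)
  have hl16 : 16 ≤ l := hp16.trans hpl
  have hl' : (16:ℝ) ≤ l := by exact_mod_cast hl16
  have hlε : 128 / ε ≤ 2 ^ l := (le_two_pow_of_le k p hk ε hε hε1 hp).trans
    (pow_le_pow_right₀ (by norm_num) hpl)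
  have hMbase : 1 ≤ 2 ^ 17 * (l:ℝ) ^ 3 / ε ^ 2 := by
    rw [le_div_iff₀ (by positivity)]
    have h1 : ε ^ 2 ≤ 1 := pow_le_one₀ hε.le hε1
    have h2 : (1:ℝ) ≤ (l:ℝ) ^ 3 := one_le_pow₀ (by linarith)
    linarith
  set M : ℕ := ⌈2 ^ 17 * (l:ℝ) ^ 3 / ε ^ 2⌉₊ with hMdef
  have hM : 2 ^ 17 * (l:ℝ) ^ 3 / ε ^ 2 ≤ M := Nat.le_ceil _
  have hM1 : 1 ≤ M := by exact_mod_cast hMbase.trans hM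
  have hM' : (M:ℝ) ≤ 2 ^ 18 * (l:ℝ) ^ 3 / ε ^ 2 := by
    have h1 := (Nat.ceil_lt_add_one (by linarith : 0 ≤ 2 ^ 17 * (l:ℝ) ^ 3 / ε ^ 2)).le
    have h2 : 2 ^ 18 * (l:ℝ) ^ 3 / ε ^ 2 = 2 * (2 ^ 17 * (l:ℝ) ^ 3 / ε ^ 2) := by ring
    rw [← hMdef] at h1
    linarith
  have hgap := pow_gap k p hk ε hε hε1 hp
  clear_value M l p D L N
  have h2k : (2:ℝ) ^ (-(k:ℝ)) = 1 / 2 ^ k := by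
    rw [Real.rpow_neg (by norm_num), Real.rpow_natCast, one_div]
  have hAp : (2:ℝ) ^ (-(d * p)) * N ^ p ≤ (A.card : ℝ) ^ p := by
    rw [← neg_mul, Real.rpow_mul (by norm_num), Real.rpow_natCast, ← mul_pow]
    gcongr
  have hCp : 1 / 2 ^ l * N ^ p ≤ (C.card : ℝ) ^ p := by
    rw [h2k] at hCk
    calc 1 / 2 ^ l * N ^ p = (1 / 2 ^ k * N) ^ p := by
          rw [mul_pow, div_pow, one_pow, hl, pow_mul]
      _ ≤ _ := by gcongr
  -- The `p`-th moment of the representation function.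
  have hmom : 1 / 2 ^ k * N * ((1 + ε) * D) ^ p ≤
      ∑ x, ((C.filter fun c => x + c ∈ A).card : ℝ) ^ p := by
    rw [h2k] at hBk
    refine le_trans ?_ (le_sum_card_filter_pow A B C hB ((1 + ε) * D) (by positivity)
      (hD ▸ mul_card_le_sum_of_le_inn A B C (Finset.card_pos.1 (by exact_mod_cast hA0)) hB hC N _
        hNc hinn) p (by omega))
    gcongr
  set R : ℝ := 1 / 2 ^ k * N * ((1 + ε) * D) ^ p with hR
  have hR0 : 0 < R := by positivity
  have hgap' : N * ((1 + ε / 2) * D) ^ p * (128 / ε) ≤ R := by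
    calc _ = 1 / 2 ^ k * N * D ^ p * ((1 + ε / 2) ^ p * (2 ^ k * (128 / ε))) := by
          rw [mul_pow]; field_simp
      _ ≤ 1 / 2 ^ k * N * D ^ p * (1 + ε) ^ p := by gcongr
      _ = R := by rw [hR, mul_pow]; ring
  have hND : N * D ^ p ≤ R := by
    calc N * D ^ p = N * (1 * D) ^ p * 1 := by ring
      _ ≤ N * ((1 + ε / 2) * D) ^ p * (128 / ε) := by
        gcongr
        · linarith
        · rw [le_div_iff₀ hε]; linarith
      _ ≤ R := hgap'
  have hDp : D ^ p = (A.card : ℝ) ^ p * (C.card : ℝ) ^ p / N ^ p := by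
    rw [hD, div_pow, mul_pow]
  obtain ⟨A', C', hA', hC', hA'c, hC'c, hsift⟩ := exists_sift A C p ((1 + ε / 2) * D) (ε / 32)
    ((2:ℝ) ^ (-(d * p)) / 4) (1 / 2 ^ l / 4) R (by positivity) (by positivity) (by positivity)
    (by positivity) hR0 hmom
    (by
      rw [hNc]
      calc _ = N * ((1 + ε / 2) * D) ^ p * (128 / ε) * (ε / 32 / 4) := by field_simp; norm_num
        _ ≤ R * (ε / 32 / 4) := by gcongr
        _ = _ := by ring)
    (by
      rw [hNc]
      calc _ = N * ((2:ℝ) ^ (-(d * p)) * N ^ p * (C.card : ℝ) ^ p / N ^ p) / 4 := by field_simp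
        _ ≤ N * ((A.card : ℝ) ^ p * (C.card : ℝ) ^ p / N ^ p) / 4 := by gcongr
        _ ≤ _ := by rw [← hDp]; gcongr)
    (by
      rw [hNc]
      calc _ = N * ((A.card : ℝ) ^ p * (1 / 2 ^ l * N ^ p) / N ^ p) / 4 := by field_simp
        _ ≤ N * ((A.card : ℝ) ^ p * (C.card : ℝ) ^ p / N ^ p) / 4 := by gcongr
        _ ≤ _ := by rw [← hDp]; gcongr)
  rw [hNc] at hA'c hC'c
  have hA'0 : (0:ℝ) < A'.card := by exact_mod_cast hA'.card_pos
  have hC'0 : (0:ℝ) < C'.card := by exact_mod_cast hC'.card_pos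
  obtain ⟨W, hWdim, hW⟩ := exists_submodule_almost_periods A' C' hA' hC'
    (fun x => if (1 + ε / 2) * D < ((C.filter fun c' => x + c' ∈ A).card : ℝ) then (1:ℝ) else 0)
    (fun x => by split_ifs <;> norm_num) (fun x => by split_ifs <;> norm_num) l M hM1
    (ε / (128 * l)) (by positivity)
  rw [hNc] at hWdim hW
  have hxA : N / A'.card ≤ 4 * (2:ℝ) ^ (d * p) := by
    rw [div_le_iff₀ hA'0]
    calc N = 4 * (2:ℝ) ^ (d * p) * ((2:ℝ) ^ (-(d * p)) / 4 * N) := by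
          rw [Real.rpow_neg (by norm_num)]; field_simp
      _ ≤ _ := by gcongr
  have hxC : N / C'.card ≤ 4 * 2 ^ l := by
    rw [div_le_iff₀ hC'0]
    calc N = 4 * 2 ^ l * (1 / 2 ^ l / 4 * N) := by field_simp
      _ ≤ _ := by gcongr
  have herr := almost_period_error_le l M hl16 ε (N / C'.card) hε (by positivity) hlε hM hxC
  obtain ⟨θ, hθ⟩ := exists_translate_of_average A C A' C' hC hA' hC' W ((1 + ε / 2) * D)
    (1 - ε / 8) ((1 + ε / 8) * A.card / N) (by positivity)
    (by
      have h1 : 1 + ε / 8 ≤ (1 - ε / 8) * (1 + ε / 2) := by nlinarith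
      calc _ = (1 + ε / 8) * D := by rw [hD]; ring
        _ ≤ (1 - ε / 8) * (1 + ε / 2) * D := by gcongr
        _ = _ := by ring)
    (fun w hw => by
      refine le_trans ?_ (hW w hw)
      have h1 : 1 - ε / 32 ≤ (∑ c ∈ C', (∑ a ∈ A',
          if (1 + ε / 2) * D < ((C.filter fun c' => a - c + c' ∈ A).card : ℝ)
            then (1:ℝ) else 0) / A'.card) / C'.card := by
        rw [← Finset.sum_div, le_div_iff₀ hC'0, le_div_iff₀ hA'0]
        exact le_trans (le_of_eq (by ring)) hsift
      linarith)
  refine ⟨W, θ, hWdim.trans (codim_bound k p M hk d ε L hd hε hL hp16 hp' hM1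
    (hl ▸ hM') _
    (by positivity) hxA), ?_⟩
  calc (1 + ε / 8) * (A.card : ℝ) * (Nat.card W : ℝ) =
        (1 + ε / 8) * A.card / N * Nat.card W * N := by field_simp
    _ ≤ _ := by gcongr
end

section
/- Let G be a finite abelian group, let A, B : G → ℝ be density functions (nonnegative with E_{x∈G} A(x) = E_{x∈G} B(x) = 1), and let k be an even positive integer. Then (E_{x∈G} ((A * B)(x) − 1)^k)² ≤ (E_{x∈G} ((A ⋆ A)(x) − 1)^k) · (E_{x∈G} ((B ⋆ B)(x) − 1)^k); equivalently, ‖A * B − 1‖_k ≤ ‖A ⋆ A − 1‖_k^{1/2} · ‖B ⋆ B − 1‖_k^{1/2}. -/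
/-- Cross-correlation: `(f ⋆ g)(x) = E_{y∈G} f(y)·g(x + y)`. -/
noncomputable def starC {G : Type*} [AddCommGroup G] [Fintype G] (f g : G → ℝ) : G → ℝ :=
  fun x => (∑ y, f y * g (x + y)) / (Fintype.card G : ℝ)

theorem sum_sq_sum_prod_translate {G : Type*} [AddCommGroup G] [Fintype G] (a : G → ℝ) (k : ℕ) :
    ∑ y : Fin k → G, (∑ t, ∏ i, a (y i + t)) ^ 2 =
      (Fintype.card G : ℝ) * ∑ x, (∑ y, a y * a (x + y)) ^ k := by
  have correlation_sum (t s : G) :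
      ∑ y, a (y + t) * a (y + s) = ∑ y, a y * a (s - t + y) :=
    Fintype.sum_equiv (Equiv.addRight t) _ _ fun y => by
      rw [Equiv.coe_addRight, show s - t + (y + t) = y + s by abel]
  calc
    _ = ∑ y : Fin k → G, ∑ t, ∑ s, ∏ i, a (y i + t) * a (y i + s) := by
      simp only [sq, Finset.sum_mul_sum, Finset.prod_mul_distrib]
    _ = ∑ t, ∑ s, ∑ y : Fin k → G, ∏ i, a (y i + t) * a (y i + s) := by
      rw [Finset.sum_comm]
      exact Finset.sum_congr rfl fun t _ => Finset.sum_comm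
    _ = ∑ t, ∑ s, (∑ y, a y * a (s - t + y)) ^ k := by
      simp only [← correlation_sum, Fintype.sum_pow]
    _ = ∑ _t : G, ∑ x, (∑ y, a y * a (x + y)) ^ k :=
      Finset.sum_congr rfl fun t _ => Fintype.sum_equiv (Equiv.subRight t) _ _ fun s => rfl
    _ = _ := by simp

theorem card_mul_sum_convolution_pow {G : Type*} [AddCommGroup G] [Fintype G]
    (a b : G → ℝ) (k : ℕ) :
    (Fintype.card G : ℝ) * ∑ x, (∑ y, a y * b (x - y)) ^ k =
      ∑ y : Fin k → G, (∑ t, ∏ i, a (y i + t)) * ∑ t, ∏ i, b (-y i + t) := by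
  have convolution_sum (t x : G) :
      ∑ y, a (y + t) * b (-y + x) = ∑ y, a y * b (x + t - y) :=
    Fintype.sum_equiv (Equiv.addRight t) _ _ fun y => by
      rw [Equiv.coe_addRight, show x + t - (y + t) = -y + x by abel]
  symm
  calc
    _ = ∑ y : Fin k → G, ∑ t, ∑ x, ∏ i, a (y i + t) * b (-y i + x) := by
      simp only [Finset.sum_mul_sum, Finset.prod_mul_distrib]
    _ = ∑ t, ∑ x, ∑ y : Fin k → G, ∏ i, a (y i + t) * b (-y i + x) := by
      rw [Finset.sum_comm]
      exact Finset.sum_congr rfl fun t _ => Finset.sum_comm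
    _ = ∑ t, ∑ x, (∑ y, a y * b (x + t - y)) ^ k := by
      simp only [← convolution_sum, Fintype.sum_pow]
    _ = ∑ _t : G, ∑ x, (∑ y, a y * b (x - y)) ^ k :=
      Finset.sum_congr rfl fun t _ => Fintype.sum_equiv (Equiv.addRight t) _ _ fun s => rfl
    _ = _ := by simp

theorem sq_sum_convolution_pow_le {G : Type*} [AddCommGroup G] [Fintype G]
    (a b : G → ℝ) (k : ℕ) :
    (∑ x, (∑ y, a y * b (x - y)) ^ k) ^ 2 ≤
      (∑ x, (∑ y, a y * a (x + y)) ^ k) * ∑ x, (∑ y, b y * b (x + y)) ^ k := by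
  have hcard : (0 : ℝ) < Fintype.card G := by exact_mod_cast Fintype.card_pos
  have cauchy := Finset.sum_mul_sq_le_sq_mul_sq Finset.univ
    (fun y : Fin k → G => ∑ t, ∏ i, a (y i + t)) (fun y => ∑ t, ∏ i, b (-y i + t))
  have reflect : ∑ y : Fin k → G, (∑ t, ∏ i, b (-y i + t)) ^ 2 =
      ∑ y : Fin k → G, (∑ t, ∏ i, b (y i + t)) ^ 2 :=
    Fintype.sum_equiv (Equiv.neg _) _ _ fun y => rfl
  rw [reflect, ← card_mul_sum_convolution_pow, sum_sq_sum_prod_translate,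
    sum_sq_sum_prod_translate] at cauchy
  refine le_of_mul_le_mul_left ?_ (pow_pos hcard 2)
  linarith

theorem convC_sub_one {G : Type*} [AddCommGroup G] [Fintype G] (f g : G → ℝ)
    (hf : (∑ x, f x) / (Fintype.card G : ℝ) = 1) (hg : (∑ x, g x) / (Fintype.card G : ℝ) = 1)
    (x : G) :
    convC f g x - 1 = (∑ y, (f y - 1) * (g (x - y) - 1)) / (Fintype.card G : ℝ) := by
  have hcard : (Fintype.card G : ℝ) ≠ 0 := by exact_mod_cast Fintype.card_ne_zero
  have translate : ∑ y, g (x - y) = ∑ y, g y :=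
    Fintype.sum_equiv (Equiv.subLeft x) _ _ fun y => rfl
  rw [div_eq_one_iff_eq hcard] at hf hg
  simp only [convC, sub_mul, mul_sub, Finset.sum_sub_distrib, mul_one, one_mul, translate, hf, hg,
    Finset.sum_const, Finset.card_univ, nsmul_eq_mul, sub_self, sub_zero]
  field_simp

theorem starC_sub_one {G : Type*} [AddCommGroup G] [Fintype G] (f g : G → ℝ)
    (hf : (∑ x, f x) / (Fintype.card G : ℝ) = 1) (hg : (∑ x, g x) / (Fintype.card G : ℝ) = 1)
    (x : G) :
    starC f g x - 1 = (∑ y, (f y - 1) * (g (x + y) - 1)) / (Fintype.card G : ℝ) := by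
  have hcard : (Fintype.card G : ℝ) ≠ 0 := by exact_mod_cast Fintype.card_ne_zero
  have translate : ∑ y, g (x + y) = ∑ y, g y :=
    Fintype.sum_equiv (Equiv.addLeft x) _ _ fun y => rfl
  rw [div_eq_one_iff_eq hcard] at hf hg
  simp only [starC, sub_mul, mul_sub, Finset.sum_sub_distrib, mul_one, one_mul, translate, hf, hg,
    Finset.sum_const, Finset.card_univ, nsmul_eq_mul, sub_self, sub_zero]
  field_simp

/-- Decoupling inequality: for density functions `A, B` and even `k`,
`‖A * B − 1‖_k ≤ ‖A ⋆ A − 1‖_k^{1/2}·‖B ⋆ B − 1‖_k^{1/2}` (in squared form). -/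
theorem decoupling_inequality {G : Type*} [AddCommGroup G] [Fintype G]
    (A B : G → ℝ) (hA0 : ∀ x, 0 ≤ A x) (hB0 : ∀ x, 0 ≤ B x)
    (hA1 : (∑ x, A x) / (Fintype.card G : ℝ) = 1)
    (hB1 : (∑ x, B x) / (Fintype.card G : ℝ) = 1)
    (k : ℕ) (hk : 0 < k) (hke : Even k) :
    ((∑ x, (convC A B x - 1) ^ k) / (Fintype.card G : ℝ)) ^ 2 ≤
      ((∑ x, (starC A A x - 1) ^ k) / (Fintype.card G : ℝ)) *
        ((∑ x, (starC B B x - 1) ^ k) / (Fintype.card G : ℝ)) := by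
  simp only [convC_sub_one A B hA1 hB1, starC_sub_one A A hA1 hA1, starC_sub_one B B hB1 hB1,
    div_pow, ← Finset.sum_div]
  rw [div_mul_div_comm, div_mul_div_comm, ← sq, ← sq]
  gcongr
  exact sq_sum_convolution_pow_le (fun x => A x - 1) (fun x => B x - 1) k
end

section
/- Let G be a finite abelian group and let f₁, f₂, …, f_t : G → ℝ be spectrally positive functions. Then E_{x∈G} [f₁(x)·f₂(x)⋯f_t(x)] ≥ (E_{x∈G} f₁(x)) · (E_{x∈G} f₂(x)) ⋯ (E_{x∈G} f_t(x)) ≥ 0. -/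
/-- A function `f : G → ℝ` is spectrally positive if every Fourier coefficient
`f̂(ψ) = E_{x∈G} f(x)·ψ(x)` is a nonnegative real number. -/
def SpectrallyPositive {G : Type*} [AddCommGroup G] [Fintype G] (f : G → ℝ) : Prop :=
  ∀ ψ : AddChar G ℂ, ∃ r : ℝ, 0 ≤ r ∧
    (∑ x, (f x : ℂ) * ψ x) / (Fintype.card G : ℂ) = (r : ℂ)

open scoped ComplexOrder

namespace SpectrallyPositive

variable {G : Type*} [AddCommGroup G] [Fintype G]

/-- The Fourier coefficient of `f` at `ψ`, with the averaging normalization. -/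
noncomputable def fourierCoeff (f : G → ℝ) (ψ : AddChar G ℂ) : ℂ :=
  (∑ x, (f x : ℂ) * ψ x) / (Fintype.card G : ℂ)

theorem iff_fourierCoeff_nonneg {f : G → ℝ} :
    SpectrallyPositive f ↔ ∀ ψ, 0 ≤ fourierCoeff f ψ := by
  refine forall_congr' fun ψ => ⟨?_, fun h => ?_⟩
  · rintro ⟨r, hr, h⟩
    rw [fourierCoeff, h]
    exact_mod_cast hr
  · rw [Complex.nonneg_iff] at h
    exact ⟨(fourierCoeff f ψ).re, h.1, Complex.ext rfl h.2.symm⟩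

theorem fourierCoeff_zero (f : G → ℝ) :
    fourierCoeff f 0 = (((∑ x, f x) / (Fintype.card G : ℝ) : ℝ) : ℂ) := by
  simp [fourierCoeff]

/-- Fourier inversion. -/
theorem sum_fourierCoeff_mul (f : G → ℝ) (y : G) :
    ∑ ψ, fourierCoeff f ψ * ψ (-y) = f y := by
  classical
  have hN : (Fintype.card G : ℂ) ≠ 0 := by exact_mod_cast Fintype.card_ne_zero
  simp only [fourierCoeff, div_mul_eq_mul_div, Finset.sum_mul, ← Finset.sum_div]
  rw [div_eq_iff hN, Finset.sum_comm]
  simp only [mul_assoc, ← AddChar.map_add_eq_mul, ← Finset.mul_sum, AddChar.sum_apply_eq_ite,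
    add_neg_eq_zero]
  simp

/-- The Fourier transform turns products into convolutions. -/
theorem fourierCoeff_mul (f g : G → ℝ) (ψ : AddChar G ℂ) :
    fourierCoeff (fun x => f x * g x) ψ = ∑ φ, fourierCoeff f φ * fourierCoeff g (ψ - φ) := by
  have h : ∀ φ, fourierCoeff f φ * fourierCoeff g (ψ - φ) =
      (∑ x, fourierCoeff f φ * φ (-x) * (g x * ψ x)) / (Fintype.card G : ℂ) := fun φ => by
    rw [fourierCoeff.eq_1 g, mul_div_assoc', Finset.mul_sum]
    congr 1
    refine Finset.sum_congr rfl fun x _ => ?_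
    rw [AddChar.sub_apply']
    rw [AddChar.map_neg_eq_inv]
    ring
  simp only [h, ← Finset.sum_div]
  rw [Finset.sum_comm]
  simp only [← Finset.sum_mul, sum_fourierCoeff_mul]
  simp [fourierCoeff, mul_assoc]

theorem one : SpectrallyPositive (fun _ : G => (1 : ℝ)) := by
  classical
  refine iff_fourierCoeff_nonneg.2 fun ψ => ?_
  simp only [fourierCoeff, Complex.ofReal_one, one_mul, AddChar.sum_eq_ite]
  split_ifs <;> simp

theorem mul {f g : G → ℝ} (hf : SpectrallyPositive f) (hg : SpectrallyPositive g) :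
    SpectrallyPositive (fun x => f x * g x) := by
  rw [iff_fourierCoeff_nonneg] at *
  intro ψ
  rw [fourierCoeff_mul]
  exact Finset.sum_nonneg fun φ _ => mul_nonneg (hf φ) (hg _)

theorem mean_nonneg {f : G → ℝ} (hf : SpectrallyPositive f) :
    0 ≤ (∑ x, f x) / (Fintype.card G : ℝ) := by
  have h := iff_fourierCoeff_nonneg.1 hf 0
  rw [fourierCoeff_zero] at h
  exact_mod_cast h

theorem mean_mul_mean_le {f g : G → ℝ} (hf : SpectrallyPositive f) (hg : SpectrallyPositive g) :
    (∑ x, f x) / (Fintype.card G : ℝ) * ((∑ x, g x) / (Fintype.card G : ℝ)) ≤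
      (∑ x, f x * g x) / (Fintype.card G : ℝ) := by
  rw [iff_fourierCoeff_nonneg] at hf hg
  have h := Finset.single_le_sum (f := fun φ => fourierCoeff f φ * fourierCoeff g (0 - φ))
    (fun φ _ => mul_nonneg (hf φ) (hg _)) (Finset.mem_univ 0)
  rw [← fourierCoeff_mul, sub_zero] at h
  simp only [fourierCoeff_zero] at h
  exact_mod_cast h

theorem prod {ι : Type*} (s : Finset ι) {f : ι → G → ℝ} (hf : ∀ i, SpectrallyPositive (f i)) :
    SpectrallyPositive (fun x => ∏ i ∈ s, f i x) := by
  classical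
  induction s using Finset.induction_on with
  | empty => simpa using one
  | insert a s ha ih =>
    simp only [Finset.prod_insert ha]
    exact (hf a).mul ih

theorem prod_mean_le {ι : Type*} (s : Finset ι) {f : ι → G → ℝ}
    (hf : ∀ i, SpectrallyPositive (f i)) :
    (∏ i ∈ s, (∑ x, f i x) / (Fintype.card G : ℝ)) ≤
      (∑ x, ∏ i ∈ s, f i x) / (Fintype.card G : ℝ) := by
  classical
  induction s using Finset.induction_on with
  | empty => simp
  | insert a s ha ih =>
    simp only [Finset.prod_insert ha]
    exact (mul_le_mul_of_nonneg_left ih (hf a).mean_nonneg).trans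
      ((hf a).mean_mul_mean_le (prod s hf))

end SpectrallyPositive

/-- Positive correlation for spectrally positive functions:
`E[f₁ f₂ ⋯ f_t] ≥ E[f₁]·E[f₂] ⋯ E[f_t] ≥ 0`. -/
theorem positive_correlation_of_spectrally_positive
    {G : Type*} [AddCommGroup G] [Fintype G] (t : ℕ) (f : Fin t → G → ℝ)
    (hf : ∀ i, SpectrallyPositive (f i)) :
    (∏ i, (∑ x, f i x) / (Fintype.card G : ℝ)) ≤
        (∑ x, ∏ i, f i x) / (Fintype.card G : ℝ) ∧
      0 ≤ ∏ i, (∑ x, f i x) / (Fintype.card G : ℝ) :=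
  ⟨SpectrallyPositive.prod_mean_le Finset.univ hf,
    Finset.prod_nonneg fun i _ => (hf i).mean_nonneg⟩
end

section
/- Let G be a finite abelian group, let D : G → ℝ be a spectrally positive density function (nonnegative with E_{x∈G} D(x) = 1), let θ ∈ G, and write (T_θ D)(x) := D(x − θ). Then for all functions f, g : G → ℝ and every even positive integer k, (E_{x∈G} (T_θ D)(x) · ((f * g)(x))^k)² ≤ (E_{x∈G} D(x) · ((f ⋆ f)(x))^k) · (E_{x∈G} D(x) · ((g ⋆ g)(x))^k). -/
open scoped ComplexConjugate

/-- The sum of a function of the difference over all pairs. -/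
theorem sum_sum_sub_eq_card_mul_sum {G : Type*} [AddCommGroup G] [Fintype G] (h : G → ℝ) :
    ∑ y, ∑ z, h (y - z) = (Fintype.card G : ℝ) * ∑ x, h x := by
  have hz (y : G) : ∑ z, h (y - z) = ∑ x, h x := (Equiv.subLeft y).sum_comp h
  simp [hz]

/-- Fourier inversion for a spectrally positive function. -/
theorem SpectrallyPositive.exists_eq_sum_addChar {G : Type*} [AddCommGroup G] [Fintype G]
    {D : G → ℝ} (hD : SpectrallyPositive D) :
    ∃ r : AddChar G ℂ → ℝ, (∀ ψ, 0 ≤ r ψ) ∧ ∀ x, (D x : ℂ) = ∑ ψ, (r ψ : ℂ) * ψ (-x) := by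
  classical
  choose r hr0 hr using hD
  refine ⟨r, hr0, fun x => ?_⟩
  have hN : (Fintype.card G : ℂ) ≠ 0 := by simp
  calc (D x : ℂ) = (∑ y, (D y : ℂ) * ∑ ψ : AddChar G ℂ, ψ (y - x)) / Fintype.card G := by
        simp [AddChar.sum_apply_eq_ite, sub_eq_zero, hN]
    _ = ∑ ψ, (r ψ : ℂ) * ψ (-x) := by
        simp_rw [← hr, Finset.mul_sum]
        rw [Finset.sum_comm, Finset.sum_div]
        refine Finset.sum_congr rfl fun ψ _ => ?_
        rw [div_mul_eq_mul_div, Finset.sum_mul]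
        simp_rw [sub_eq_add_neg, AddChar.map_add_eq_mul, mul_assoc]

theorem SpectrallyPositive.map_neg {G : Type*} [AddCommGroup G] [Fintype G]
    {D : G → ℝ} (hD : SpectrallyPositive D) (x : G) : D (-x) = D x := by
  obtain ⟨r, -, hr⟩ := hD.exists_eq_sum_addChar
  have h : (D (-x) : ℂ) = conj (D x : ℂ) := by
    rw [hr, hr, map_sum]
    refine Finset.sum_congr rfl fun ψ _ => ?_
    rw [map_mul, Complex.conj_ofReal, ← AddChar.map_neg_eq_conj]
  rw [Complex.conj_ofReal] at h
  exact_mod_cast h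

theorem SpectrallyPositive.sum_mul_mul_self_nonneg {G : Type*} [AddCommGroup G] [Fintype G]
    {D : G → ℝ} (hD : SpectrallyPositive D) (a : G → ℝ) :
    0 ≤ ∑ y, ∑ z, D (y - z) * (a y * a z) := by
  obtain ⟨r, hr0, hr⟩ := hD.exists_eq_sum_addChar
  have h : ((∑ y, ∑ z, D (y - z) * (a y * a z) : ℝ) : ℂ) =
      ((∑ ψ, r ψ * Complex.normSq (∑ z, (a z : ℂ) * ψ z) : ℝ) : ℂ) := by
    push_cast
    simp_rw [Complex.normSq_eq_conj_mul_self, hr, map_sum, map_mul, Complex.conj_ofReal,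
      ← AddChar.map_neg_eq_conj, Finset.sum_mul_sum, Finset.mul_sum, Finset.sum_mul]
    conv_rhs => rw [Finset.sum_comm]
    refine Finset.sum_congr rfl fun y _ => ?_
    conv_rhs => rw [Finset.sum_comm]
    refine Finset.sum_congr rfl fun z _ => Finset.sum_congr rfl fun ψ _ => ?_
    rw [show -(y - z) = -y + z by abel, AddChar.map_add_eq_mul]
    ring
  rw [Complex.ofReal_inj.mp h]
  exact Finset.sum_nonneg fun ψ _ => mul_nonneg (hr0 ψ) (Complex.normSq_nonneg _)

/-- The Cauchy–Schwarz inequality for the form with kernel `D (y - z)`, summed over an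
auxiliary index. -/
theorem SpectrallyPositive.sum_mul_mul_sq_le {G ι : Type*} [AddCommGroup G] [Fintype G]
    [Fintype ι] {D : G → ℝ} (hD : SpectrallyPositive D) (a b : ι → G → ℝ) :
    (∑ u, ∑ y, ∑ z, D (y - z) * (a u y * b u z)) ^ 2 ≤
      (∑ u, ∑ y, ∑ z, D (y - z) * (a u y * a u z)) *
        (∑ u, ∑ y, ∑ z, D (y - z) * (b u y * b u z)) := by
  have hsymm : ∑ u, ∑ y, ∑ z, D (y - z) * (b u y * a u z) =
      ∑ u, ∑ y, ∑ z, D (y - z) * (a u y * b u z) := by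
    refine Finset.sum_congr rfl fun u _ => ?_
    rw [Finset.sum_comm]
    refine Finset.sum_congr rfl fun y _ => Finset.sum_congr rfl fun z _ => ?_
    rw [← hD.map_neg, neg_sub, mul_comm (b u z)]
  have hquad (t : ℝ) : 0 ≤ (∑ u, ∑ y, ∑ z, D (y - z) * (a u y * a u z)) * (t * t) +
      (2 * ∑ u, ∑ y, ∑ z, D (y - z) * (a u y * b u z)) * t +
      ∑ u, ∑ y, ∑ z, D (y - z) * (b u y * b u z) := by
    have h : 0 ≤ ∑ u, ∑ y, ∑ z,
        D (y - z) * ((t * a u y + b u y) * (t * a u z + b u z)) :=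
      Finset.sum_nonneg fun u _ => hD.sum_mul_mul_self_nonneg fun y => t * a u y + b u y
    convert h using 1
    rw [two_mul]
    nth_rewrite 2 [← hsymm]
    simp_rw [add_mul, Finset.sum_mul, ← Finset.sum_add_distrib]
    refine Finset.sum_congr rfl fun u _ => Finset.sum_congr rfl fun y _ =>
      Finset.sum_congr rfl fun z _ => ?_
    ring
  have h := discrim_le_zero hquad
  rw [discrim] at h
  linarith

/-- A sum over `k`-tuples of shifts, where the inner sum over one shift depends only on the
difference of the two outer variables. -/
theorem sum_mul_prod_eq_card_mul_sum_pow {G : Type*} [AddCommGroup G] [Fintype G]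
    (D : G → ℝ) (p q : G → G → ℝ) (s : G → ℝ) (k : ℕ)
    (hs : ∀ y z, ∑ v, p v y * q v z = s (y - z)) :
    ∑ u : Fin k → G, ∑ y, ∑ z, D (y - z) * ((∏ i, p (u i) y) * ∏ i, q (u i) z) =
      (Fintype.card G : ℝ) * ∑ x, D x * s x ^ k := by
  rw [← sum_sum_sub_eq_card_mul_sum, Finset.sum_comm]
  refine Finset.sum_congr rfl fun y _ => ?_
  rw [Finset.sum_comm]
  refine Finset.sum_congr rfl fun z _ => ?_
  rw [← hs, Fintype.sum_pow, Finset.mul_sum]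
  simp_rw [Finset.prod_mul_distrib]

/-- Local decoupling inequality: for a spectrally positive density `D`, a shift `θ`, and
even `k`: `(E (T_θD)(x)·((f*g)(x))^k)² ≤ (E D(x)·((f⋆f)(x))^k)·(E D(x)·((g⋆g)(x))^k)`. -/
theorem local_decoupling_inequality {G : Type*} [AddCommGroup G] [Fintype G]
    (D : G → ℝ) (hD0 : ∀ x, 0 ≤ D x)
    (hD1 : (∑ x, D x) / (Fintype.card G : ℝ) = 1)
    (hDspec : SpectrallyPositive D) (θ : G) (f g : G → ℝ)
    (k : ℕ) (hk : 0 < k) (hke : Even k) :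
    ((∑ x, D (x - θ) * (convC f g x) ^ k) / (Fintype.card G : ℝ)) ^ 2 ≤
      ((∑ x, D x * (starC f f x) ^ k) / (Fintype.card G : ℝ)) *
        ((∑ x, D x * (starC g g x) ^ k) / (Fintype.card G : ℝ)) := by
  have hN : (0 : ℝ) < Fintype.card G := by exact_mod_cast Fintype.card_pos
  have hfg (y z : G) : ∑ v, f (v + y) * g (θ - z - v) =
      (fun x => ∑ w, f w * g (x + θ - w)) (y - z) := by
    refine Fintype.sum_equiv (Equiv.addRight y) _ _ fun v => ?_
    simp only [Equiv.coe_addRight]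
    congr 2; abel
  have hff (y z : G) : ∑ v, f (v + y) * f (v + z) =
      (fun x => ∑ w, f w * f (x + w)) (y - z) := by
    refine Fintype.sum_equiv (Equiv.addRight z) _ _ fun v => ?_
    simp only [Equiv.coe_addRight]
    rw [mul_comm]
    congr 2; abel
  have hgg (y z : G) : ∑ v, g (θ - y - v) * g (θ - z - v) =
      (fun x => ∑ w, g w * g (x + w)) (y - z) := by
    refine Fintype.sum_equiv (Equiv.subLeft (θ - y)) _ _ fun v => ?_
    simp only [Equiv.subLeft_apply]
    congr 2; abel
  have key := hDspec.sum_mul_mul_sq_le (ι := Fin k → G) (fun u y => ∏ i, f (u i + y))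
    (fun u z => ∏ i, g (θ - z - u i))
  rw [sum_mul_prod_eq_card_mul_sum_pow D (fun v y => f (v + y)) (fun v z => g (θ - z - v))
      (fun x => ∑ w, f w * g (x + θ - w)) k hfg,
    sum_mul_prod_eq_card_mul_sum_pow D (fun v y => f (v + y)) (fun v y => f (v + y))
      (fun x => ∑ w, f w * f (x + w)) k hff,
    sum_mul_prod_eq_card_mul_sum_pow D (fun v z => g (θ - z - v)) (fun v z => g (θ - z - v))
      (fun x => ∑ w, g w * g (x + w)) k hgg] at key
  have hshift : ∑ x, D x * (∑ w, f w * g (x + θ - w)) ^ k =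
      ∑ x, D (x - θ) * (∑ w, f w * g (x - w)) ^ k :=
    Fintype.sum_equiv (Equiv.addRight θ) _ _ fun x => by simp
  rw [hshift, mul_pow, mul_mul_mul_comm, ← sq] at key
  have key' := le_of_mul_le_mul_left key (by positivity)
  have hdiv := div_le_div_of_nonneg_right key'
    (show 0 ≤ ((Fintype.card G : ℝ) ^ k * Fintype.card G) ^ 2 by positivity)
  simp only [convC, starC, div_pow _ _ k, ← mul_div_assoc, ← Finset.sum_div, div_div]
  rwa [div_pow, div_mul_eq_mul_div, div_div, ← sq]
end

section
/- Let Ω be a nonempty finite set, let w : Ω → ℝ be nonnegative weights with Σ_{x∈Ω} w(x) = 1, and let X : Ω → ℝ. Write E_w[Y] := Σ_{x∈Ω} w(x)·Y(x). Suppose that E_w[(X − 1)^t] ≥ 0 for every odd positive integer t, and that E_w[|X − 1|^{k₀}] ≥ ε^{k₀} for some even integer k₀ ≥ 2 and some ε ∈ (0, 1]. Then for every integer k′ ≥ 2·k₀/ε, E_w[|X|^{k′}] ≥ (1/4)·(1 + ε)^{k′}. -/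
lemma le_sum_mul_pow_of_le {Ω : Type*} [Fintype Ω] {w Y : Ω → ℝ} (hw0 : ∀ x, 0 ≤ w x)
    (hw1 : ∑ x, w x = 1) (hY : ∀ x, 0 ≤ Y x) {ε : ℝ} (hε : 0 < ε) {k j : ℕ} (hk : 0 < k)
    (hkj : k ≤ j) (h : ε ^ k ≤ ∑ x, w x * Y x ^ k) : ε ^ j ≤ ∑ x, w x * Y x ^ j := by
  have hk' : (0 : ℝ) < k := by exact_mod_cast hk
  have hp : (1 : ℝ) ≤ j / k := by
    rw [le_div_iff₀ hk', one_mul]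
    exact_mod_cast hkj
  have bernoulli : ∀ y : ℝ, 0 ≤ y → 1 + (j / k : ℝ) * (y ^ k - 1) ≤ y ^ j := by
    intro y hy
    have hyk : 0 ≤ y ^ k := pow_nonneg hy k
    refine (one_add_mul_self_le_rpow_one_add (by linarith : -1 ≤ y ^ k - 1) hp).trans_eq ?_
    rw [add_sub_cancel, ← Real.rpow_natCast, ← Real.rpow_mul hy, mul_div_cancel₀ _ hk'.ne',
      Real.rpow_natCast]
  have hscaled : ∀ i : ℕ, ∑ x, w x * (Y x / ε) ^ i = (∑ x, w x * Y x ^ i) / ε ^ i := by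
    intro i
    rw [Finset.sum_div]
    exact Finset.sum_congr rfl fun x _ => by rw [div_pow, mul_div_assoc]
  have hone : 1 ≤ ∑ x, w x * (Y x / ε) ^ k := by
    rw [hscaled, le_div_iff₀ (by positivity), one_mul]
    exact h
  have hmain : 1 ≤ ∑ x, w x * (Y x / ε) ^ j :=
    calc (1 : ℝ) ≤ 1 + (j / k : ℝ) * (∑ x, w x * (Y x / ε) ^ k - 1) := by
          have : 0 ≤ (j / k : ℝ) * (∑ x, w x * (Y x / ε) ^ k - 1) :=
            mul_nonneg (by positivity) (by linarith)
          linarith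
      _ = ∑ x, w x * (1 + (j / k : ℝ) * ((Y x / ε) ^ k - 1)) := by
          simp only [mul_add, mul_sub, mul_one, Finset.sum_add_distrib, Finset.sum_sub_distrib,
            hw1, Finset.mul_sum, mul_left_comm]
          simp only [mul_comm (w _) (j / k : ℝ), ← Finset.mul_sum, hw1, mul_one]
      _ ≤ ∑ x, w x * (Y x / ε) ^ j := Finset.sum_le_sum fun x _ =>
          mul_le_mul_of_nonneg_left (bernoulli _ (div_nonneg (hY x) hε.le)) (hw0 x)
  rw [hscaled, le_div_iff₀ (by positivity), one_mul] at hmain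
  exact hmain

lemma choose_sub_le_choose_add_mul_pow {ε : ℝ} (hε0 : 0 < ε) (hε1 : ε ≤ 1) {m n : ℕ}
    (hn : 2 * (m : ℝ) ≤ n * ε) {d : ℕ} (hd : d ≤ m) :
    (n.choose (m - d) : ℝ) ≤ n.choose (m + d) * ε ^ (2 * d) := by
  induction d with
  | zero => simp
  | succ d ih =>
    have hn2 : 2 * m ≤ n := by
      have : 2 * (m : ℝ) ≤ n := hn.trans (mul_le_of_le_one_right (Nat.cast_nonneg n) hε1)
      exact_mod_cast this
    obtain ⟨i, rfl⟩ := Nat.exists_eq_add_of_le' hd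
    have ih := ih (by omega)
    rw [show i + (d + 1) - d = i + 1 by omega] at ih
    rw [show i + (d + 1) - (d + 1) = i by omega]
    have hlow : (n.choose (i + 1) : ℝ) * (i + 1) = n.choose i * (n - i) := by
      rw [← Nat.cast_sub (by omega : i ≤ n)]
      exact_mod_cast Nat.choose_succ_right_eq n i
    have hhigh : (n.choose (i + (d + 1) + (d + 1)) : ℝ) * (i + 2 * d + 2) =
        n.choose (i + (d + 1) + d) * (n - (i + 2 * d + 1)) := by
      have := Nat.choose_succ_right_eq n (i + (d + 1) + d)
      have hc := congrArg (Nat.cast : ℕ → ℝ) this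
      push_cast [Nat.cast_sub (by omega : i + (d + 1) + d ≤ n)] at hc
      rw [show i + (d + 1) + (d + 1) = i + (d + 1) + d + 1 by omega]
      linear_combination hc
    have hnR : 2 * ((i : ℝ) + (d + 1)) ≤ n * ε := by
      push_cast at hn
      exact hn
    have hnR2 : 2 * ((i : ℝ) + (d + 1)) ≤ n := by exact_mod_cast hn2
    have hi : (0 : ℝ) ≤ i := Nat.cast_nonneg i
    have hd0 : (0 : ℝ) ≤ d := Nat.cast_nonneg d
    have h1 : (i : ℝ) + 1 ≤ ε * (n - (i + 2 * d + 1)) := by nlinarith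
    have h2 : (i : ℝ) + 2 * d + 2 ≤ ε * (n - i) := by nlinarith
    have hpos : (0 : ℝ) < n - i := by linarith
    have hpos' : (0 : ℝ) < i + 2 * d + 2 := by linarith
    set A := (n.choose (i + (d + 1) + d) : ℝ)
    set B := (n.choose (i + (d + 1) + (d + 1)) : ℝ)
    have hA : 0 ≤ A := Nat.cast_nonneg _
    have hB : 0 ≤ B := Nat.cast_nonneg _
    refine le_of_mul_le_mul_right ?_ hpos
    calc (n.choose i : ℝ) * (n - i) = n.choose (i + 1) * (i + 1) := hlow.symm
      _ ≤ A * ε ^ (2 * d) * (ε * (n - (i + 2 * d + 1))) := by gcongr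
      _ = B * ε ^ (2 * d) * ε * (i + 2 * d + 2) := by
          linear_combination (-(ε ^ (2 * d) * ε)) * hhigh
      _ ≤ B * ε ^ (2 * d) * ε * (ε * (n - i)) := by gcongr
      _ = B * ε ^ (2 * (d + 1)) * (n - i) := by ring

lemma one_add_pow_le_two_mul_sum_even {ε : ℝ} (hε1 : ε ≤ 1) (n : ℕ) :
    (1 + ε) ^ n ≤ 2 * ∑ j ∈ Finset.range (n + 1) with Even j, n.choose j * ε ^ j := by
  have hsub : 0 ≤ (1 - ε) ^ n := pow_nonneg (by linarith) n
  have hsum : (1 + ε) ^ n + (1 - ε) ^ n =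
      2 * ∑ j ∈ Finset.range (n + 1) with Even j, n.choose j * ε ^ j := by
    rw [add_comm 1 ε, sub_eq_neg_add, add_pow, add_pow, ← Finset.sum_add_distrib,
      Finset.sum_filter, Finset.mul_sum]
    refine Finset.sum_congr rfl fun j _ => ?_
    split_ifs with hj
    · rw [hj.neg_pow]
      ring
    · rw [(Nat.not_even_iff_odd.mp hj).neg_pow]
      ring
  linarith

lemma one_add_pow_le_four_mul_sum_even_ge {ε : ℝ} (hε0 : 0 < ε) (hε1 : ε ≤ 1) {m n : ℕ}
    (hn : 2 * (m : ℝ) ≤ n * ε) :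
    (1 + ε) ^ n ≤
      4 * ∑ j ∈ Finset.range (n + 1) with Even j ∧ m ≤ j, n.choose j * ε ^ j := by
  have hn2 : 2 * m ≤ n := by
    have : 2 * (m : ℝ) ≤ n := hn.trans (mul_le_of_le_one_right (Nat.cast_nonneg n) hε1)
    exact_mod_cast this
  have hlow : ∑ j ∈ Finset.range (n + 1) with Even j ∧ ¬ m ≤ j, (n.choose j : ℝ) * ε ^ j ≤
      ∑ j ∈ Finset.range (n + 1) with Even j ∧ m ≤ j, n.choose j * ε ^ j := by
    calc ∑ j ∈ Finset.range (n + 1) with Even j ∧ ¬ m ≤ j, (n.choose j : ℝ) * ε ^ j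
        ≤ ∑ j ∈ Finset.range (n + 1) with Even j ∧ ¬ m ≤ j,
            (n.choose (2 * m - j) : ℝ) * ε ^ (2 * m - j) := by
          refine Finset.sum_le_sum fun j hj => ?_
          simp only [Finset.mem_filter] at hj
          have h := choose_sub_le_choose_add_mul_pow hε0 hε1 hn (Nat.sub_le m j)
          rw [show m - (m - j) = j by omega, show m + (m - j) = 2 * m - j by omega] at h
          calc (n.choose j : ℝ) * ε ^ j
              ≤ n.choose (2 * m - j) * ε ^ (2 * (m - j)) * ε ^ j := by gcongr
            _ = n.choose (2 * m - j) * ε ^ (2 * m - j) := by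
              rw [mul_assoc, ← pow_add, show 2 * (m - j) + j = 2 * m - j by omega]
      _ = ∑ j ∈ (Finset.range (n + 1)).filter (fun j => Even j ∧ ¬ m ≤ j) |>.image
            (fun j => 2 * m - j), (n.choose j : ℝ) * ε ^ j := by
          rw [Finset.sum_image]
          intro a ha b hb hab
          simp only [Finset.coe_filter, Set.mem_ofPred_eq] at ha hb
          dsimp only at hab
          omega
      _ ≤ _ := by
          refine Finset.sum_le_sum_of_subset_of_nonneg ?_ fun j _ _ => by positivity
          intro j hj
          simp only [Finset.mem_image, Finset.mem_filter, Finset.mem_range] at hj ⊢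
          obtain ⟨i, ⟨-, he, hi⟩, rfl⟩ := hj
          exact ⟨by omega, by rw [Nat.even_sub (by omega)]; simp [he], by omega⟩
  have hsplit := Finset.sum_filter_add_sum_filter_not
    ((Finset.range (n + 1)).filter Even) (fun j => m ≤ j) (fun j => (n.choose j : ℝ) * ε ^ j)
  rw [Finset.filter_filter, Finset.filter_filter] at hsplit
  have := one_add_pow_le_two_mul_sum_even hε1 n
  linarith


/-- Odd-moments lemma: if `X` has nonnegative odd central moments (about 1) and
`E_w[|X − 1|^{k₀}] ≥ ε^{k₀}`, then `E_w[|X|^{k'}] ≥ (1/4)·(1+ε)^{k'}` for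
all integers `k' ≥ 2k₀/ε`. -/
theorem odd_moments_lower_bound {Ω : Type*} [Fintype Ω] [Nonempty Ω]
    (w : Ω → ℝ) (hw0 : ∀ x, 0 ≤ w x) (hw1 : ∑ x, w x = 1) (X : Ω → ℝ)
    (hodd : ∀ t : ℕ, Odd t → 0 < t → 0 ≤ ∑ x, w x * (X x - 1) ^ t)
    (k₀ : ℕ) (hk₀2 : 2 ≤ k₀) (hk₀e : Even k₀)
    (ε : ℝ) (hε0 : 0 < ε) (hε1 : ε ≤ 1)
    (hdev : ε ^ k₀ ≤ ∑ x, w x * |X x - 1| ^ k₀) :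
    ∀ k' : ℕ, 2 * (k₀ : ℝ) / ε ≤ (k' : ℝ) →
      (1/4) * (1 + ε) ^ k' ≤ ∑ x, w x * |X x| ^ k' := by
  intro n hn
  rw [div_le_iff₀ hε0] at hn
  have hmoment : ∀ j, Even j → k₀ ≤ j → ε ^ j ≤ ∑ x, w x * (X x - 1) ^ j := by
    intro j hj hkj
    simpa only [hj.pow_abs] using le_sum_mul_pow_of_le hw0 hw1 (fun x => abs_nonneg (X x - 1))
      hε0 (by omega) hkj hdev
  have hnonneg : ∀ j, 0 ≤ ∑ x, w x * (X x - 1) ^ j := by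
    intro j
    rcases Nat.even_or_odd j with hj | hj
    · exact Finset.sum_nonneg fun x _ => mul_nonneg (hw0 x) (hj.pow_nonneg _)
    · exact hodd j hj hj.pos
  have hexpand : ∑ x, w x * X x ^ n =
      ∑ j ∈ Finset.range (n + 1), n.choose j * ∑ x, w x * (X x - 1) ^ j := by
    simp only [Finset.mul_sum]
    rw [Finset.sum_comm]
    refine Finset.sum_congr rfl fun x _ => ?_
    conv_lhs => rw [← sub_add_cancel (X x) 1, add_pow, Finset.mul_sum]
    exact Finset.sum_congr rfl fun j _ => by ring
  calc 1 / 4 * (1 + ε) ^ n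
      ≤ ∑ j ∈ Finset.range (n + 1) with Even j ∧ k₀ ≤ j, n.choose j * ε ^ j := by
        linarith [one_add_pow_le_four_mul_sum_even_ge hε0 hε1 hn]
    _ ≤ ∑ j ∈ Finset.range (n + 1) with Even j ∧ k₀ ≤ j,
          n.choose j * ∑ x, w x * (X x - 1) ^ j := by
        refine Finset.sum_le_sum fun j hj => ?_
        obtain ⟨-, hje, hjk⟩ := Finset.mem_filter.mp hj
        exact mul_le_mul_of_nonneg_left (hmoment j hje hjk) (Nat.cast_nonneg _)
    _ ≤ ∑ j ∈ Finset.range (n + 1), n.choose j * ∑ x, w x * (X x - 1) ^ j :=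
        Finset.sum_le_sum_of_subset_of_nonneg (Finset.filter_subset _ _) fun j _ _ =>
          mul_nonneg (Nat.cast_nonneg _) (hnonneg j)
    _ = ∑ x, w x * X x ^ n := hexpand.symm
    _ ≤ ∑ x, w x * |X x| ^ n := Finset.sum_le_sum fun x _ =>
        mul_le_mul_of_nonneg_left ((le_abs_self _).trans_eq (abs_pow _ _)) (hw0 x)
end

section
/- Let F be a finite field with q elements, n ≥ 1, let ε ∈ (0, 1], let r be a positive integer, and suppose A ⊆ 𝔽_q^n has |A| ≥ 2^{−d}·q^n for some real d ≥ 1. Then there exist an F-linear subspace V of 𝔽_q^n of codimension s ≤ r·d/ε and a shift θ ∈ 𝔽_q^n such that the subset A′ := A ∩ (θ + V) satisfies: (1) |A′| · q^n ≥ |A| · |V|; and (2) for every affine subspace W of 𝔽_q^n with W ⊆ θ + V and dim(W) ≥ dim(V) − r, one has |A′ ∩ W| · |V| ≤ (1 + ε) · |A′| · |W|. -/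
open scoped Classical

/-- The number of points of `A` in `θ + V` relative to the size of `V`. -/
noncomputable def cosetDensity {F M : Type*} [Field F] [AddCommGroup M] [Module F M]
    (A : Finset M) (V : Submodule F M) (θ : M) : ℝ :=
  ((A.filter fun x => x - θ ∈ V).card : ℝ) / Nat.card V

theorem cosetDensity_le_one {F M : Type*} [Field F] [AddCommGroup M] [Module F M] [Finite M]
    (A : Finset M) (V : Submodule F M) (θ : M) : cosetDensity A V θ ≤ 1 := by
  have hle : (A.filter fun x => x - θ ∈ V).card ≤ Nat.card V := by
    rw [← Nat.card_eq_finsetCard]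
    exact Nat.card_le_card_of_injective
      (fun x : {x // x ∈ A.filter fun x => x - θ ∈ V} =>
        (⟨x - θ, (Finset.mem_filter.1 x.2).2⟩ : V))
      fun x y hxy => Subtype.ext (sub_left_injective (congrArg Subtype.val hxy))
  exact div_le_one_of_le₀ (by exact_mod_cast hle) (Nat.cast_nonneg _)

/-- Among all cosets, one maximizes the density weighted by an exponential of the dimension. -/
theorem exists_coset_maximizing_weighted_density {F M : Type*} [Field F] [AddCommGroup M]
    [Module F M] [Finite M] (A : Finset M) (c : ℝ) :
    ∃ (V : Submodule F M) (θ : M), ∀ (W : Submodule F M) (θ' : M),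
      cosetDensity A W θ' ≤ cosetDensity A V θ *
        (2 : ℝ) ^ (c * ((Module.finrank F V : ℝ) - Module.finrank F W)) := by
  obtain ⟨⟨V, θ⟩, h⟩ := Finite.exists_max fun p : Submodule F M × M =>
    cosetDensity A p.1 p.2 * (2 : ℝ) ^ (c * (Module.finrank F p.1 : ℝ))
  refine ⟨V, θ, fun W θ' => ?_⟩
  have hW := h (W, θ')
  rw [mul_sub, Real.rpow_sub two_pos, ← mul_div_assoc]
  exact (le_div_iff₀ (by positivity)).2 hW

/-- Greedy density-increment: any dense `A ⊆ 𝔽_q^n` has a restriction to a coset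
`θ + V` of codimension at most `r·d/ε` on which it is at least as dense as in `𝔽_q^n`
and is `(1+ε, r)`-spread relative to `θ + V`. -/
theorem pass_to_spread_subset (F : Type) [Field F] [Fintype F] [DecidableEq F]
    (n : ℕ) (hn : 1 ≤ n) (ε : ℝ) (hε0 : 0 < ε) (hε1 : ε ≤ 1)
    (r : ℕ) (hr : 0 < r) (d : ℝ) (hd : 1 ≤ d) (A : Finset (Fin n → F))
    (hA : (2:ℝ) ^ (-d) * (Fintype.card F : ℝ) ^ n ≤ A.card) :
    ∃ (V : Submodule F (Fin n → F)) (θ : Fin n → F),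
      ((n:ℝ) - Module.finrank F V) ≤ r * d / ε ∧
      -- (1) the density of A' := A ∩ (θ + V) in θ + V is at least that of A in 𝔽_q^n
      (A.card : ℝ) * (Nat.card V : ℝ) ≤
        ((A.filter fun x => x - θ ∈ V).card : ℝ) * (Fintype.card F : ℝ) ^ n ∧
      -- (2) A' is (1+ε, r)-spread inside θ + V
      (∀ (W : Submodule F (Fin n → F)) (θ' : Fin n → F),
        {x : Fin n → F | x - θ' ∈ W} ⊆ {x : Fin n → F | x - θ ∈ V} →
        Module.finrank F V ≤ Module.finrank F W + r →
        (((A.filter fun x => x - θ ∈ V).filter fun x => x - θ' ∈ W).card : ℝ) *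
            (Nat.card V : ℝ) ≤
          (1 + ε) * ((A.filter fun x => x - θ ∈ V).card : ℝ) * (Nat.card W : ℝ)) := by
  have hr' : (0 : ℝ) < r := by exact_mod_cast hr
  have hcard : ∀ U : Submodule F (Fin n → F), (0 : ℝ) < Nat.card U := fun U => by
    exact_mod_cast Nat.card_pos
  have hq : (0 : ℝ) < (Fintype.card F : ℝ) ^ n := by
    have : 0 < Fintype.card F := Fintype.card_pos
    positivity
  obtain ⟨V, θ, h⟩ := exists_coset_maximizing_weighted_density (F := F) A (ε / r)
  have hfin : (Module.finrank F V : ℝ) ≤ n := by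
    have := Submodule.finrank_le V
    rw [Module.finrank_fin_fun] at this
    exact_mod_cast this
  have hV0 : 0 ≤ cosetDensity A V θ := by unfold cosetDensity; positivity
  have htop : (A.card : ℝ) / (Fintype.card F : ℝ) ^ n ≤ cosetDensity A V θ *
      (2 : ℝ) ^ (ε / r * ((Module.finrank F V : ℝ) - n)) := by
    simpa [cosetDensity] using h ⊤ 0
  refine ⟨V, θ, ?_, ?_, ?_⟩
  · have hpow : (2 : ℝ) ^ (-d) ≤ (2 : ℝ) ^ (ε / r * ((Module.finrank F V : ℝ) - n)) :=
      ((le_div_iff₀ hq).2 hA).trans <| htop.trans <|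
        mul_le_of_le_one_left (by positivity) (cosetDensity_le_one A V θ)
    have hexp := (Real.rpow_le_rpow_left_iff one_lt_two).1 hpow
    rw [div_mul_eq_mul_div, le_div_iff₀ hr'] at hexp
    rw [le_div_iff₀ hε0]
    linarith
  · have hdens : (A.card : ℝ) / (Fintype.card F : ℝ) ^ n ≤ cosetDensity A V θ :=
      htop.trans <| mul_le_of_le_one_right hV0 <|
        Real.rpow_le_one_of_one_le_of_nonpos one_le_two <|
          mul_nonpos_of_nonneg_of_nonpos (by positivity) (by linarith)
    exact (div_le_div_iff₀ hq (hcard V)).1 hdens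
  · intro W θ' _ hW
    have hW' : (Module.finrank F V : ℝ) ≤ Module.finrank F W + r := by exact_mod_cast hW
    have hexp : ε / r * ((Module.finrank F V : ℝ) - Module.finrank F W) ≤ ε := by
      rw [div_mul_eq_mul_div, div_le_iff₀ hr']
      exact mul_le_mul_of_nonneg_left (by linarith) hε0.le
    have hpow : (2 : ℝ) ^ (ε / r * ((Module.finrank F V : ℝ) - Module.finrank F W)) ≤ 1 + ε := by
      refine (Real.rpow_le_rpow_of_exponent_le one_le_two hexp).trans ?_
      have := rpow_one_add_le_one_add_mul_self (s := 1) (by norm_num) hε0.le hε1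
      norm_num at this
      exact this
    have hdens : cosetDensity A W θ' ≤ cosetDensity A V θ * (1 + ε) :=
      (h W θ').trans (mul_le_mul_of_nonneg_left hpow hV0)
    have hsub : (((A.filter fun x => x - θ ∈ V).filter fun x => x - θ' ∈ W).card : ℝ) ≤
        (A.filter fun x => x - θ' ∈ W).card := by
      exact_mod_cast Finset.card_le_card (Finset.filter_subset_filter _ (Finset.filter_subset _ _))
    refine (mul_le_mul_of_nonneg_right hsub (hcard V).le).trans ?_
    rw [cosetDensity, cosetDensity, div_mul_eq_mul_div,
      div_le_div_iff₀ (hcard W) (hcard V)] at hdens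
    linarith
end
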